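/- arXiv:1212.5796 — 3 statements merged into one kernel-verified Lean document; each statement's English description precedes it below -/
import Mathlib

section
/- Typical bounded differences inequality for asymmetric variables. Let X=(X_1,...,X_N) be a family of independent random variables with X_k taking values in Λ_k and satisfying max_{η∈Λ_k} P(X_k = η) ≥ 1 − p_k. Let Γ be an event in the product space and assume f satisfies the typical Lipschitz condition (TL) relative to Γ with coefficients c_k ≤ d_k. Then for any (γ_k)_{k∈[N]} with γ_k ∈ (0,1] there exists an event B = B(Γ,(γ_k)) with P(B) ≤ Σ_{k∈[N]} γ_k^{-1}·P(X ∉ Γ) and complement contained in Γ, such that, setting μ = E f(X), e_k = γ_k(d_k − c_k) and C = max_{k∈[N]} (c_k + e_k), for every t ≥ 0 one has P(f(X) ≥ μ + t and not B) ≤ exp(−t² / (2 Σ_{k∈[N]} p_k(c_k + e_k·(1−p_k)^{-1})² + 2Ct/3)). -/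
open MeasureTheory

namespace TBD

universe u

lemma exp_le_aux {x y : ℝ} (hxy : x ≤ y) (hy : y < 3) :
    Real.exp x ≤ 1 + x + x ^ 2 / (2 * (1 - y / 3)) := by
  have key : ∀ x : ℝ, x < 3 → 1 ≤ (1 + x + (3 / 2) * x ^ 2 / (3 - x)) * Real.exp (-x) := by
    set u : ℝ → ℝ := fun x => (1 + x + (3 / 2) * x ^ 2 / (3 - x)) * Real.exp (-x) with hu
    have hder : ∀ x : ℝ, x < 3 →
        HasDerivAt u ((1 / 2 * x ^ 3 / (3 - x) ^ 2) * Real.exp (-x)) x := by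
      intro x hx
      have h3 : (3 - x) ≠ 0 := by linarith
      have h1 : HasDerivAt (fun x : ℝ => 1 + x + (3 / 2) * x ^ 2 / (3 - x))
          (1 + ((3 / 2 * (2 * x)) * (3 - x) - (3 / 2) * x ^ 2 * (-1)) / (3 - x) ^ 2) x := by
        have a1 : HasDerivAt (fun x : ℝ => 1 + x) 1 x := (hasDerivAt_id x).const_add 1
        have a2 : HasDerivAt (fun x : ℝ => (3 / 2) * x ^ 2) (3 / 2 * (2 * x)) x := by
          simpa using (hasDerivAt_pow 2 x).const_mul (3 / 2 : ℝ)
        have a3 : HasDerivAt (fun x : ℝ => 3 - x) (-1) x := (hasDerivAt_id x).const_sub 3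
        exact a1.add (a2.div a3 h3)
      have h2 : HasDerivAt (fun x : ℝ => Real.exp (-x)) (Real.exp (-x) * (-1)) x :=
        (hasDerivAt_neg x).exp
      refine (h1.mul h2).congr_deriv ?_
      field_simp
      ring
    intro x hx
    have u0 : u 0 = 1 := by simp [hu]
    change 1 ≤ u x
    rw [← u0]
    rcases le_total 0 x with h | h
    · have hm : MonotoneOn u (Set.Ico 0 3) := by
        apply monotoneOn_of_deriv_nonneg (convex_Ico 0 3)
        · intro z hz
          exact (hder z hz.2).continuousAt.continuousWithinAt
        · intro z hz
          rw [interior_Ico] at hz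
          exact (hder z hz.2).differentiableAt.differentiableWithinAt
        · intro z hz
          rw [interior_Ico] at hz
          rw [(hder z hz.2).deriv]
          have := hz.1
          positivity
      exact hm ⟨le_rfl, by norm_num⟩ ⟨h, hx⟩ h
    · have hm : AntitoneOn u (Set.Iic 0) := by
        apply antitoneOn_of_deriv_nonpos (convex_Iic 0)
        · intro z hz
          have hz : z ≤ 0 := hz
          exact (hder z (by linarith)).continuousAt.continuousWithinAt
        · intro z hz
          rw [interior_Iic] at hz
          have hz : z < 0 := hz
          exact (hder z (by linarith)).differentiableAt.differentiableWithinAt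
        · intro z hz
          rw [interior_Iic] at hz
          have hz : z < 0 := hz
          rw [(hder z (by linarith)).deriv]
          have h3 : z ^ 3 ≤ 0 := by
            have : 0 ≤ (-z) ^ 3 := by apply pow_nonneg; linarith
            nlinarith
          apply mul_nonpos_of_nonpos_of_nonneg _ (Real.exp_pos _).le
          apply div_nonpos_of_nonpos_of_nonneg _ (sq_nonneg _)
          linarith
      exact hm h (Set.mem_Iic.2 le_rfl) h
  have hx : x < 3 := by linarith
  have h1 := key x hx
  rw [Real.exp_neg, ← div_eq_mul_inv, le_div_iff₀ (Real.exp_pos _), one_mul] at h1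
  refine h1.trans ?_
  have h4 : (3 / 2) * x ^ 2 / (3 - x) = x ^ 2 / (2 * (1 - x / 3)) := by
    have : 3 - x ≠ 0 := by linarith
    have : 1 - x / 3 ≠ 0 := by intro h; apply this; linarith
    field_simp
  rw [h4]
  have : 0 < 1 - y / 3 := by linarith
  gcongr

/-- one-coordinate step -/
lemma one_step {α : Type u} [MeasurableSpace α] [MeasurableSingletonClass α]
    (P : Measure α) [IsProbabilityMeasure P] (p : ℝ) (hp0 : 0 ≤ p) (hp1 : p < 1)
    (η : α) (hη : 1 - p ≤ (P {η}).toReal)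
    (h : α → ℝ) (hh : Measurable h) (M : ℝ) (hM : ∀ a, |h a| ≤ M)
    (q : α → ℝ) (hq : Measurable q) (hq0 : ∀ a, 0 ≤ q a) (hq1 : ∀ a, q a ≤ 1)
    (c d γ C : ℝ) (hcd : c ≤ d) (hc0 : 0 ≤ c) (hγ : 0 ≤ γ)
    (hTL : ∀ a b, |h a - h b| ≤ c + (d - c) * q b)
    (hqγ : ∫ a, q a ∂P ≤ γ) (hC : c + γ * (d - c) ≤ C)
    (l : ℝ) (hl : 0 ≤ l) (hlC : l * C < 3) :
    ∫⁻ a, ENNReal.ofReal (Real.exp (l * (h a - ∫ b, h b ∂P))) ∂P ≤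
      ENNReal.ofReal (Real.exp (l ^ 2 / (2 * (1 - l * C / 3)) *
        (p * (c + γ * (d - c) / (1 - p)) ^ 2))) := by
  have ih : Integrable h P := Integrable.of_bound hh.aestronglyMeasurable M (ae_of_all _ hM)
  have iq : Integrable q P := Integrable.of_bound hq.aestronglyMeasurable 1
    (ae_of_all _ fun a => by rw [Real.norm_eq_abs, abs_of_nonneg (hq0 a)]; exact hq1 a)
  set m := ∫ b, h b ∂P with hm
  set D := c + γ * (d - c) / (1 - p) with hD
  set ψ := l ^ 2 / (2 * (1 - l * C / 3)) with hψ
  have hp1' : 0 < 1 - p := by linarith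
  have hψ0 : 0 ≤ ψ := by
    have : 0 < 1 - l * C / 3 := by linarith
    positivity
  have hdc : 0 ≤ d - c := by linarith
  have hD0 : 0 ≤ D := by positivity
  -- bound on increments
  have hinc : ∀ a, h a - m ≤ C := by
    intro a
    have h1 : h a - m = ∫ b, (h a - h b) ∂P := by
      rw [integral_sub (integrable_const _) ih]; simp [hm]
    have h2 : ∫ b, (h a - h b) ∂P ≤ ∫ b, (c + (d - c) * q b) ∂P := by
      apply integral_mono ((integrable_const _).sub ih)
        ((integrable_const _).add (iq.const_mul _))
      intro b
      exact (le_abs_self _).trans (hTL a b)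
    have h3 : ∫ b, (c + (d - c) * q b) ∂P = c + (d - c) * ∫ b, q b ∂P := by
      rw [integral_add (integrable_const _) (iq.const_mul _), integral_const_mul]; simp
    have h4 : (d - c) * ∫ b, q b ∂P ≤ (d - c) * γ := by gcongr
    linarith
  have hqη : q η ≤ γ / (1 - p) := by
    rw [le_div_iff₀ hp1']
    have h1 : ∫ a in {η}, q a ∂P ≤ ∫ a, q a ∂P :=
      setIntegral_le_integral iq (ae_of_all _ hq0)
    rw [integral_singleton] at h1
    have h2 : q η * (1 - p) ≤ q η * (P {η}).toReal := by
      have := hq0 η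
      gcongr
    simp only [Measure.real, smul_eq_mul] at h1
    linarith
  have hη' : ∀ a, |h a - h η| ≤ D := by
    intro a
    refine (hTL a η).trans ?_
    have : (d - c) * q η ≤ (d - c) * (γ / (1 - p)) := by gcongr
    rw [hD]
    calc _ ≤ c + (d - c) * (γ / (1 - p)) := by linarith
      _ = _ := by ring
  have isq : ∀ r : ℝ, Integrable (fun a => (h a - r) ^ 2) P := by
    intro r
    refine Integrable.of_bound ((hh.sub_const r).pow_const 2).aestronglyMeasurable ((M + |r|) ^ 2)
      (ae_of_all _ fun a => ?_)
    rw [Real.norm_eq_abs, abs_pow]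
    gcongr
    exact (abs_sub _ _).trans (by gcongr; exact hM a)
  have hv1 : ∫ a, (h a - h η) ^ 2 ∂P ≤ p * D ^ 2 := by
    have h1 : ∫ a, (h a - h η) ^ 2 ∂P ≤ ∫ a, ({η}ᶜ : Set α).indicator (fun _ => D ^ 2) a ∂P := by
      apply integral_mono (isq _)
        ((integrable_const _).indicator (measurableSet_singleton η).compl)
      intro a
      by_cases ha : a = η
      · simp [ha]
      · have : a ∈ ({η}ᶜ : Set α) := by simpa using ha
        simp only [Set.indicator_of_mem this]
        rw [← sq_abs]
        gcongr
        exact hη' a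
    rw [integral_indicator_const _ (measurableSet_singleton η).compl, smul_eq_mul,
      probReal_compl_eq_one_sub (measurableSet_singleton η)] at h1
    refine h1.trans ?_
    simp only [Measure.real]
    gcongr
    linarith
  have hv : ∫ a, (h a - m) ^ 2 ∂P ≤ p * D ^ 2 := by
    refine le_trans ?_ hv1
    have h1 : ∫ a, (h a - h η) ^ 2 ∂P
        = ∫ a, ((h a - m) ^ 2 + (2 * (m - h η) * (h a - m) + (m - h η) ^ 2)) ∂P := by
      congr 1; ext a; ring
    have i1 : Integrable (fun a => 2 * (m - h η) * (h a - m)) P :=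
      (ih.sub (integrable_const m)).const_mul _
    have i1' : Integrable (fun a => 2 * (m - h η) * (h a - m) + (m - h η) ^ 2) P :=
      i1.add (integrable_const _)
    rw [h1, integral_add (isq m) i1',
      integral_add i1 (integrable_const _), integral_const_mul,
      integral_sub ih (integrable_const _)]
    simp only [integral_const, probReal_univ, one_smul, ← hm, sub_self, mul_zero, zero_add]
    nlinarith [sq_nonneg (m - h η)]
  have i2 : Integrable (fun a => 1 + l * (h a - m) + ψ * (h a - m) ^ 2) P :=
    ((integrable_const _).add ((ih.sub (integrable_const m)).const_mul l)).add
      ((isq m).const_mul ψ)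
  have hpt : ∀ a, Real.exp (l * (h a - m)) ≤ 1 + l * (h a - m) + ψ * (h a - m) ^ 2 := by
    intro a
    have h1 : l * (h a - m) ≤ l * C := by gcongr; exact hinc a
    refine (exp_le_aux h1 hlC).trans (le_of_eq ?_)
    rw [hψ, mul_pow]; ring
  calc _ ≤ ∫⁻ a, ENNReal.ofReal (1 + l * (h a - m) + ψ * (h a - m) ^ 2) ∂P := by
        apply lintegral_mono
        intro a
        exact ENNReal.ofReal_le_ofReal (hpt a)
    _ = ENNReal.ofReal (∫ a, (1 + l * (h a - m) + ψ * (h a - m) ^ 2) ∂P) := by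
        rw [ofReal_integral_eq_lintegral_ofReal i2]
        exact ae_of_all _ fun a => (Real.exp_pos _).le.trans (hpt a)
    _ ≤ _ := by
        apply ENNReal.ofReal_le_ofReal
        have i3 : Integrable (fun a => l * (h a - m)) P :=
          (ih.sub (integrable_const m)).const_mul _
        have i3' : Integrable (fun a => 1 + l * (h a - m)) P := (integrable_const _).add i3
        rw [integral_add i3' ((isq m).const_mul ψ),
          integral_add (integrable_const _) i3, integral_const_mul, integral_const_mul,
          integral_sub ih (integrable_const _)]
        simp only [integral_const, probReal_univ, one_smul, ← hm, sub_self, mul_zero, add_zero]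
        have : ψ * ∫ a, (h a - m) ^ 2 ∂P ≤ ψ * (p * D ^ 2) := by gcongr
        have := Real.add_one_le_exp (ψ * (p * D ^ 2))
        linarith

lemma measurable_cons {N : ℕ} {Λ : Fin (N + 1) → Type u} [∀ k, MeasurableSpace (Λ k)] :
    Measurable (fun z : Λ 0 × (∀ i : Fin N, Λ i.succ) => (Fin.cons z.1 z.2 : ∀ i, Λ i)) := by
  rw [measurable_pi_iff]
  intro i
  refine Fin.cases ?_ (fun j => ?_) i
  · simpa using measurable_fst
  · simp only [Fin.cons_succ]; fun_prop

lemma mp_cons {N : ℕ} {Λ : Fin (N + 1) → Type u} [∀ k, MeasurableSpace (Λ k)]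
    (P : ∀ k, Measure (Λ k)) [∀ k, IsProbabilityMeasure (P k)] :
    MeasurePreserving (fun z : Λ 0 × (∀ i : Fin N, Λ i.succ) => (Fin.cons z.1 z.2 : ∀ i, Λ i))
      ((P 0).prod (Measure.pi fun i : Fin N => P i.succ)) (Measure.pi P) := by
  refine ⟨measurable_cons, ?_⟩
  symm
  apply Measure.pi_eq
  intro s hs
  rw [Measure.map_apply measurable_cons (MeasurableSet.univ_pi hs)]
  have : (fun z : Λ 0 × (∀ i : Fin N, Λ i.succ) => (Fin.cons z.1 z.2 : ∀ i, Λ i)) ⁻¹'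
      (Set.univ.pi s) = s 0 ×ˢ (Set.univ.pi fun i : Fin N => s i.succ) := by
    ext z
    simp only [Set.mem_preimage, Set.mem_pi, Set.mem_univ, true_imp_iff, Set.mem_prod]
    rw [Fin.forall_fin_succ]
    simp
  rw [this, Measure.prod_prod, Measure.pi_pi, Fin.prod_univ_succ]

/-- combine the coordinates of `x` before `k` with those of `y` from `k` on -/
def mix {N : ℕ} {Λ : Fin N → Type u} (k : Fin N) (x y : ∀ j, Λ j) : ∀ j, Λ j :=
  fun j => if j < k then x j else y j

lemma measurable_mix {N : ℕ} {Λ : Fin N → Type u} [∀ k, MeasurableSpace (Λ k)] (k : Fin N) :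
    Measurable (fun z : (∀ j, Λ j) × (∀ j, Λ j) => mix k z.1 z.2) := by
  rw [measurable_pi_iff]
  intro j
  unfold mix
  by_cases h : j < k
  · simp only [h, if_true]; fun_prop
  · simp only [h, if_false]; fun_prop

lemma mp_mix {N : ℕ} {Λ : Fin N → Type u} [∀ k, MeasurableSpace (Λ k)]
    (P : ∀ k, Measure (Λ k)) [∀ k, IsProbabilityMeasure (P k)] (k : Fin N) :
    MeasurePreserving (fun z : (∀ j, Λ j) × (∀ j, Λ j) => mix k z.1 z.2)
      ((Measure.pi P).prod (Measure.pi P)) (Measure.pi P) := by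
  refine ⟨measurable_mix k, ?_⟩
  symm
  apply Measure.pi_eq
  intro s hs
  rw [Measure.map_apply (measurable_mix k) (MeasurableSet.univ_pi hs)]
  have : (fun z : (∀ j, Λ j) × (∀ j, Λ j) => mix k z.1 z.2) ⁻¹' (Set.univ.pi s) =
      (Set.univ.pi fun j => if j < k then s j else Set.univ) ×ˢ
      (Set.univ.pi fun j => if j < k then Set.univ else s j) := by
    ext z
    simp only [Set.mem_preimage, Set.mem_pi, Set.mem_univ, true_imp_iff, Set.mem_prod, mix]
    rw [← forall_and]
    apply forall_congr'
    intro j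
    by_cases h : j < k <;> simp [h]
  rw [this, Measure.prod_prod, Measure.pi_pi, Measure.pi_pi, ← Finset.prod_mul_distrib]
  apply Finset.prod_congr rfl
  intro j _
  by_cases h : j < k <;> simp [h]

/-- conditional probability of the complement of `Γ` given the coordinates before `k` -/
noncomputable def A {N : ℕ} {Λ : Fin N → Type u} [∀ k, MeasurableSpace (Λ k)]
    (P : ∀ k, Measure (Λ k)) (Γ : Set (∀ j, Λ j)) (k : Fin N) (x : ∀ j, Λ j) : ENNReal :=
  Measure.pi P {y | mix k x y ∉ Γ}

lemma measurable_A {N : ℕ} {Λ : Fin N → Type u} [∀ k, MeasurableSpace (Λ k)]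
    (P : ∀ k, Measure (Λ k)) [∀ k, IsProbabilityMeasure (P k)]
    {Γ : Set (∀ j, Λ j)} (hΓ : MeasurableSet Γ) (k : Fin N) : Measurable (A P Γ k) :=
  measurable_measure_prodMk_left (ν := Measure.pi P) ((measurable_mix k) hΓ.compl)

lemma lintegral_A {N : ℕ} {Λ : Fin N → Type u} [∀ k, MeasurableSpace (Λ k)]
    (P : ∀ k, Measure (Λ k)) [∀ k, IsProbabilityMeasure (P k)]
    {Γ : Set (∀ j, Λ j)} (hΓ : MeasurableSet Γ) (k : Fin N) :
    ∫⁻ x, A P Γ k x ∂(Measure.pi P) = Measure.pi P Γᶜ := by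
  rw [← (mp_mix P k).measure_preimage hΓ.compl.nullMeasurableSet,
    Measure.prod_apply ((measurable_mix k) hΓ.compl)]
  rfl

lemma A_zero {N : ℕ} {Λ : Fin (N + 1) → Type u} [∀ k, MeasurableSpace (Λ k)]
    (P : ∀ k, Measure (Λ k)) (Γ : Set (∀ j, Λ j)) (x : ∀ j, Λ j) :
    A P Γ 0 x = Measure.pi P Γᶜ := by
  have : ∀ y, mix 0 x y = y := by intro y; funext j; simp [mix]
  simp only [A, this]; rfl

lemma A_succ {N : ℕ} {Λ : Fin (N + 1) → Type u} [∀ k, MeasurableSpace (Λ k)]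
    (P : ∀ k, Measure (Λ k)) [∀ k, IsProbabilityMeasure (P k)]
    {Γ : Set (∀ j, Λ j)} (hΓ : MeasurableSet Γ) (k : Fin N) (a : Λ 0)
    (x : ∀ j : Fin N, Λ j.succ) :
    A P Γ k.succ (Fin.cons a x) =
      A (fun i : Fin N => P i.succ) {x | (Fin.cons a x : ∀ i, Λ i) ∈ Γ} k x := by
  unfold A
  have hm : MeasurableSet {y | mix k.succ (Fin.cons a x : ∀ i, Λ i) y ∉ Γ} :=
    ((measurable_mix k.succ).comp measurable_prodMk_left) hΓ.compl
  rw [← (mp_cons P).measure_preimage hm.nullMeasurableSet]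
  have : (fun z : Λ 0 × (∀ i : Fin N, Λ i.succ) => (Fin.cons z.1 z.2 : ∀ i, Λ i)) ⁻¹'
      {y | mix k.succ (Fin.cons a x : ∀ i, Λ i) y ∉ Γ} = Set.univ ×ˢ
      {y | mix k x y ∉ {x | (Fin.cons a x : ∀ i, Λ i) ∈ Γ}} := by
    ext z
    have : mix k.succ (Fin.cons a x : ∀ i, Λ i) (Fin.cons z.1 z.2) = Fin.cons a (mix k x z.2) := by
      funext j
      refine Fin.cases ?_ (fun j => ?_) j
      · simp [mix]
      · simp [mix]
    simp [this]
  rw [this, Measure.prod_prod, measure_univ, one_mul]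

lemma mgf (N : ℕ) : ∀ {Λ : Fin N → Type u} [∀ k, MeasurableSpace (Λ k)]
    [∀ k, MeasurableSingletonClass (Λ k)]
    (P : ∀ k, Measure (Λ k)) [∀ k, IsProbabilityMeasure (P k)]
    (p : Fin N → ℝ) (_ : ∀ k, 0 ≤ p k) (_ : ∀ k, p k < 1)
    (_ : ∀ k, ∃ η : Λ k, 1 - p k ≤ (P k {η}).toReal)
    (f : (∀ k, Λ k) → ℝ) (_ : Measurable f) (M : ℝ) (_ : ∀ x, |f x| ≤ M)
    (Γ : Set (∀ k, Λ k)) (_ : MeasurableSet Γ)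
    (c d : Fin N → ℝ) (_ : ∀ k, c k ≤ d k) (_ : ∀ k, 0 ≤ c k)
    (_ : ∀ (k : Fin N) (x x' : ∀ j, Λ j), (∀ j, j ≠ k → x j = x' j) →
      (x ∈ Γ → |f x - f x'| ≤ c k) ∧ (x ∉ Γ → |f x - f x'| ≤ d k))
    (γ : Fin N → ℝ) (_ : ∀ k, 0 ≤ γ k)
    (C : ℝ) (_ : ∀ k, c k + γ k * (d k - c k) ≤ C)
    (l : ℝ) (_ : 0 ≤ l) (_ : l * C < 3)
    (G : Set (∀ k, Λ k)) (_ : MeasurableSet G)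
    (_ : ∀ x ∈ G, ∀ k, A P Γ k x < ENNReal.ofReal (γ k)),
    ∫⁻ x, G.indicator
      (fun x => ENNReal.ofReal (Real.exp (l * (f x - ∫ y, f y ∂(Measure.pi P))))) x
        ∂(Measure.pi P) ≤
      ENNReal.ofReal (Real.exp (l ^ 2 / (2 * (1 - l * C / 3)) *
        ∑ k, p k * (c k + γ k * (d k - c k) / (1 - p k)) ^ 2)) := by
  induction N with
  | zero =>
    intro Λ _ _ P _ p hp0 hp1 hp f hf M hM Γ hΓ c d hcd hc0 hTL γ hγ C hC l hl hlC G hG hGA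
    have h1 : ∀ x, G.indicator
        (fun x => ENNReal.ofReal (Real.exp (l * (f x - ∫ y, f y ∂(Measure.pi P))))) x ≤ 1 := by
      intro x
      refine (Set.indicator_le_self' (by simp) x).trans ?_
      have : f = fun _ => f x := by funext y; rw [Subsingleton.elim x y]
      have h2 : ∫ y, f y ∂(Measure.pi P) = f x := by rw [this]; simp
      simp [h2]
    calc _ ≤ ∫⁻ x, 1 ∂(Measure.pi P) := lintegral_mono h1
      _ ≤ _ := by simp
  | succ N ih =>
    intro Λ _ _ P _ p hp0 hp1 hp f hf M hM Γ hΓ c d hcd hc0 hTL γ hγ C hC l hl hlC G hG hGA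
    rcases G.eq_empty_or_nonempty with rfl | ⟨x₀, hx₀⟩
    · simp
    have hA0 : Measure.pi P Γᶜ < ENNReal.ofReal (γ 0) := by
      have := hGA x₀ hx₀ 0
      rwa [A_zero] at this
    set π' := Measure.pi (fun i : Fin N => P i.succ) with hπ'
    have hcons : ∀ a : Λ 0,
        Measurable (fun x : (∀ i : Fin N, Λ i.succ) => (Fin.cons a x : ∀ i, Λ i)) :=
      fun a => measurable_cons.comp measurable_prodMk_left
    set h : Λ 0 → ℝ := fun a => ∫ x, f (Fin.cons a x) ∂π' with hh
    have hf2 : Measurable fun z : Λ 0 × (∀ i : Fin N, Λ i.succ) => f (Fin.cons z.1 z.2) :=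
      hf.comp measurable_cons
    have if2 : Integrable (fun z : Λ 0 × (∀ i : Fin N, Λ i.succ) => f (Fin.cons z.1 z.2))
        ((P 0).prod π') :=
      Integrable.of_bound hf2.aestronglyMeasurable M (ae_of_all _ fun z => hM _)
    have ifa : ∀ a, Integrable (fun x => f (Fin.cons a x)) π' := fun a =>
      Integrable.of_bound (hf.comp (hcons a)).aestronglyMeasurable M (ae_of_all _ fun z => hM _)
    have hhm : Measurable h :=
      (hf2.stronglyMeasurable.integral_prod_right (ν := π')).measurable
    have hhM : ∀ a, |h a| ≤ M := by
      intro a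
      have := norm_integral_le_of_norm_le_const (μ := π') (f := fun x => f (Fin.cons a x))
        (C := M) (ae_of_all _ fun z => hM _)
      simpa using this
    have hmean : ∫ y, f y ∂(Measure.pi P) = ∫ a, h a ∂(P 0) := by
      rw [← (mp_cons P).map_eq, integral_map measurable_cons.aemeasurable
        hf.aestronglyMeasurable, integral_prod _ if2]
    have hΓ2 : MeasurableSet {z : Λ 0 × (∀ i : Fin N, Λ i.succ) |
        (Fin.cons z.1 z.2 : ∀ i, Λ i) ∉ Γ} := measurable_cons hΓ.compl
    have hΓa : ∀ a : Λ 0, MeasurableSet {x : (∀ i : Fin N, Λ i.succ) |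
        (Fin.cons a x : ∀ i, Λ i) ∉ Γ} := fun a => hcons a hΓ.compl
    set q : Λ 0 → ℝ := fun a => (π' {x | (Fin.cons a x : ∀ i, Λ i) ∉ Γ}).toReal with hq
    have hqm' : Measurable fun a => π' {x | (Fin.cons a x : ∀ i, Λ i) ∉ Γ} :=
      measurable_measure_prodMk_left (ν := π') hΓ2
    have hqm : Measurable q := hqm'.ennreal_toReal
    have hqint : ∫ a, q a ∂(P 0) ≤ γ 0 := by
      rw [hq, integral_toReal hqm'.aemeasurable (ae_of_all _ fun a => measure_lt_top _ _)]
      have : ∫⁻ a, π' {x | (Fin.cons a x : ∀ i, Λ i) ∉ Γ} ∂(P 0) = Measure.pi P Γᶜ := by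
        rw [← (mp_cons P).measure_preimage hΓ.compl.nullMeasurableSet,
          Measure.prod_apply (measurable_cons hΓ.compl)]
        rfl
      rw [this]
      exact ENNReal.toReal_le_of_le_ofReal (hγ 0) hA0.le
    have hTL0 : ∀ a b, |h a - h b| ≤ c 0 + (d 0 - c 0) * q b := by
      intro a b
      have e1 : h a - h b = ∫ x, (f (Fin.cons a x) - f (Fin.cons b x)) ∂π' := by
        rw [integral_sub (ifa a) (ifa b)]
      have i4 : Integrable (({x : (∀ i : Fin N, Λ i.succ) |
          (Fin.cons b x : ∀ i, Λ i) ∉ Γ}).indicator (fun _ => d 0 - c 0)) π' :=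
        (integrable_const _).indicator (hΓa b)
      rw [e1]
      refine (abs_integral_le_integral_abs).trans ?_
      calc ∫ x, |f (Fin.cons a x) - f (Fin.cons b x)| ∂π'
          ≤ ∫ x, (c 0 + ({x : (∀ i : Fin N, Λ i.succ) |
          (Fin.cons b x : ∀ i, Λ i) ∉ Γ}).indicator (fun _ => d 0 - c 0) x) ∂π' := by
            apply integral_mono ((ifa a).sub (ifa b)).abs ((integrable_const _).add i4)
            intro x
            have ht := hTL 0 (Fin.cons b x) (Fin.cons a x) (by
              intro j
              refine Fin.cases ?_ (fun j => ?_) j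
              · intro h; exact absurd rfl h
              · intro _; simp)
            change |f (Fin.cons a x) - f (Fin.cons b x)| ≤ c 0 + ({x : (∀ i : Fin N, Λ i.succ) |
              (Fin.cons b x : ∀ i, Λ i) ∉ Γ}).indicator (fun _ => d 0 - c 0) x
            rw [abs_sub_comm]
            by_cases hx : (Fin.cons b x : ∀ i, Λ i) ∈ Γ
            · simpa [Set.indicator, hx] using ht.1 hx
            · simpa [Set.indicator, hx] using ht.2 hx
        _ = c 0 + (d 0 - c 0) * q b := by
            rw [integral_add (integrable_const _) i4, integral_indicator_const _ (hΓa b)]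
            simp [hq, Measure.real, mul_comm]
    obtain ⟨η, hη⟩ := hp 0
    have step := one_step (P 0) (p 0) (hp0 0) (hp1 0) η hη h hhm M hhM q hqm
      (fun a => ENNReal.toReal_nonneg)
      (fun a => by
        have : (π' {x | (Fin.cons a x : ∀ i, Λ i) ∉ Γ}).toReal ≤ 1 := measureReal_le_one
        exact this)
      (c 0) (d 0) (γ 0) C (hcd 0) (hc0 0) (hγ 0) hTL0 hqint (hC 0) l hl hlC
    rw [← hmean] at step
    set m := ∫ y, f y ∂(Measure.pi P) with hm
    set ψ := l ^ 2 / (2 * (1 - l * C / 3)) with hψ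
    set K := ENNReal.ofReal (Real.exp (ψ * ∑ k : Fin N,
      p k.succ * (c k.succ + γ k.succ * (d k.succ - c k.succ) / (1 - p k.succ)) ^ 2)) with hK
    have IH : ∀ a : Λ 0, ∫⁻ x, ({x : (∀ i : Fin N, Λ i.succ) |
          (Fin.cons a x : ∀ i, Λ i) ∈ G}).indicator
        (fun x => ENNReal.ofReal (Real.exp (l * (f (Fin.cons a x) - h a)))) x ∂π' ≤ K := by
      intro a
      refine ih (fun i : Fin N => P i.succ) (fun k => p k.succ) (fun k => hp0 _) (fun k => hp1 _)
        (fun k => hp _) (fun x => f (Fin.cons a x)) (hf.comp (hcons a)) M (fun x => hM _)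
        {x | (Fin.cons a x : ∀ i, Λ i) ∈ Γ} (hcons a hΓ)
        (fun k => c k.succ) (fun k => d k.succ) (fun k => hcd _) (fun k => hc0 _) ?_
        (fun k => γ k.succ) (fun k => hγ _) C (fun k => hC _) l hl hlC
        {x | (Fin.cons a x : ∀ i, Λ i) ∈ G} (hcons a hG) ?_
      · intro k x x' hxx
        refine hTL k.succ (Fin.cons a x) (Fin.cons a x') ?_
        intro j
        refine Fin.cases ?_ (fun j => ?_) j
        · intro _; rfl
        · intro hj
          simpa using hxx j (fun e => hj (by rw [e]))
      · intro x hx k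
        rw [← A_succ P hΓ]
        exact hGA _ hx _
    have hF : Measurable (G.indicator
        (fun x => ENNReal.ofReal (Real.exp (l * (f x - m))))) := by
      apply Measurable.indicator _ hG
      fun_prop
    rw [← (mp_cons P).lintegral_comp hF, lintegral_prod _ (hF.comp' measurable_cons).aemeasurable]
    calc _ ≤ ∫⁻ a, ENNReal.ofReal (Real.exp (l * (h a - m))) * K ∂(P 0) := by
          apply lintegral_mono
          intro a
          refine le_trans (le_of_eq ?_) (mul_le_mul_right (IH a) _)
          rw [← lintegral_const_mul]
          · refine lintegral_congr fun x => ?_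
            by_cases hx : (Fin.cons a x : ∀ i, Λ i) ∈ G
            · simp only [Set.indicator, hx, if_true, Set.mem_setOf_eq]
              rw [← ENNReal.ofReal_mul (Real.exp_pos _).le, ← Real.exp_add]
              congr 2; ring
            · simp [Set.indicator, hx]
          · apply Measurable.indicator _ (hcons a hG)
            have := hf.comp (hcons a)
            have h2 : Measurable fun x => f (Fin.cons a x) := this
            fun_prop
      _ = (∫⁻ a, ENNReal.ofReal (Real.exp (l * (h a - m))) ∂(P 0)) * K := by
          rw [lintegral_mul_const]
          fun_prop
      _ ≤ ENNReal.ofReal (Real.exp (ψ * (p 0 * (c 0 + γ 0 * (d 0 - c 0) / (1 - p 0)) ^ 2))) * K :=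
          by gcongr
      _ = _ := by
          rw [hK, ← ENNReal.ofReal_mul (Real.exp_pos _).le, ← Real.exp_add, ← mul_add,
            Fin.sum_univ_succ]

lemma optimize {V C t : ℝ} (hV : 0 ≤ V) (hC : 0 ≤ C) (ht : 0 ≤ t)
    (h0 : 2 * V + 2 * C * t / 3 ≠ 0) :
    ∃ l : ℝ, 0 ≤ l ∧ l * C < 3 ∧
      -(l * t) + l ^ 2 / (2 * (1 - l * C / 3)) * V ≤ -t ^ 2 / (2 * V + 2 * C * t / 3) := by
  have hCt : 0 ≤ C * t := by positivity
  rcases hV.eq_or_lt with rfl | hV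
  · have hC' : C ≠ 0 := by rintro rfl; simp at h0
    have ht' : t ≠ 0 := by rintro rfl; simp at h0
    refine ⟨3 / (2 * C), by positivity, ?_, le_of_eq ?_⟩
    · have : 3 / (2 * C) * C = 3 / 2 := by field_simp
      rw [this]; norm_num
    · field_simp
      ring
  · have hW : 0 < V + C * t / 3 := by positivity
    refine ⟨t / (V + C * t / 3), by positivity, ?_, le_of_eq ?_⟩
    · rw [div_mul_eq_mul_div, div_lt_iff₀ hW]; linarith
    · have e1 : 1 - t / (V + C * t / 3) * C / 3 = V / (V + C * t / 3) := by
        field_simp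
        ring
      have e2 : 2 * V + 2 * C * t / 3 = 2 * (V + C * t / 3) := by ring
      rw [e1, e2]
      generalize V + C * t / 3 = W at *
      field_simp
      ring

end TBD

/-- **Typical bounded differences inequality for asymmetric variables**
(Remark 1.6 / Theorem 1.3 of Warnke, general version).
`X = (X_1, …, X_N)` is modeled by the product measure `Measure.pi P` of the laws
`P k` of the independent coordinates; `max_{η ∈ Λ_k} P(X_k = η) ≥ 1 - p_k`. -/
theorem typical_bounded_differences_asymmetric {N : ℕ} {Λ : Fin N → Type*}
    [∀ k, MeasurableSpace (Λ k)] [∀ k, MeasurableSingletonClass (Λ k)]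
    (P : ∀ k, Measure (Λ k)) [∀ k, IsProbabilityMeasure (P k)]
    (p : Fin N → ℝ) (hp0 : ∀ k, 0 ≤ p k) (hp1 : ∀ k, p k < 1)
    (hp : ∀ k, ∃ η : Λ k, 1 - p k ≤ (P k {η}).toReal)
    (f : (∀ k, Λ k) → ℝ) (hf : Measurable f) (hfb : ∃ M : ℝ, ∀ x, |f x| ≤ M)
    (Γ : Set (∀ k, Λ k)) (hΓ : MeasurableSet Γ)
    (c d : Fin N → ℝ) (hcd : ∀ k, c k ≤ d k)
    -- the typical Lipschitz condition (TL)
    (hTL : ∀ (k : Fin N) (x x' : ∀ j, Λ j), (∀ j, j ≠ k → x j = x' j) →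
      (x ∈ Γ → |f x - f x'| ≤ c k) ∧ (x ∉ Γ → |f x - f x'| ≤ d k))
    (γ : Fin N → ℝ) (hγ : ∀ k, γ k ∈ Set.Ioc (0 : ℝ) 1)
    -- `C = max_k (c_k + e_k)` where `e_k = γ_k (d_k - c_k)`
    (C : ℝ) (hC : IsGreatest (Set.range fun k => c k + γ k * (d k - c k)) C) :
    ∃ B : Set (∀ k, Λ k), MeasurableSet B ∧
      Measure.pi P B ≤ ∑ k, ENNReal.ofReal ((γ k)⁻¹) * Measure.pi P Γᶜ ∧
      Bᶜ ⊆ Γ ∧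
      ∀ t : ℝ, 0 ≤ t →
        Measure.pi P {x | f x ≥ (∫ y, f y ∂(Measure.pi P)) + t ∧ x ∉ B} ≤
          ENNReal.ofReal (Real.exp (-t ^ 2 /
            (2 * ∑ k, p k * (c k + γ k * (d k - c k) / (1 - p k)) ^ 2 +
              2 * C * t / 3))) := by
  obtain ⟨M, hM⟩ := hfb
  obtain ⟨k₀, -⟩ := hC.1
  obtain ⟨n, rfl⟩ : ∃ n, N = n + 1 := ⟨N - 1, by have := k₀.2; omega⟩
  have hγ0 : ∀ k, 0 < γ k := fun k => (hγ k).1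
  have hone : ∀ k, 1 ≤ ENNReal.ofReal ((γ k)⁻¹) := by
    intro k
    rw [ENNReal.one_le_ofReal]
    exact (one_le_inv₀ (hγ0 k)).2 (hγ k).2
  by_cases hbig : ENNReal.ofReal (γ 0) ≤ Measure.pi P Γᶜ
  · refine ⟨Set.univ, MeasurableSet.univ, ?_, by simp, by simp⟩
    refine le_trans ?_ (Finset.single_le_sum (f := fun k => ENNReal.ofReal ((γ k)⁻¹) *
      Measure.pi P Γᶜ) (fun _ _ => zero_le) (Finset.mem_univ 0))
    calc Measure.pi P Set.univ ≤ ENNReal.ofReal ((γ 0)⁻¹) * ENNReal.ofReal (γ 0) := by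
          rw [← ENNReal.ofReal_mul (inv_nonneg.2 (hγ0 0).le), inv_mul_cancel₀ (hγ0 0).ne']
          simp
      _ ≤ _ := by gcongr
  · push Not at hbig
    have hΓne : Γ.Nonempty := by
      rw [Set.nonempty_iff_ne_empty]
      rintro rfl
      rw [Set.compl_empty, measure_univ] at hbig
      have : ENNReal.ofReal (γ 0) ≤ 1 := ENNReal.ofReal_le_one.2 (hγ 0).2
      exact absurd hbig (not_lt.2 this)
    obtain ⟨x₀, hx₀⟩ := hΓne
    have hc0 : ∀ k, 0 ≤ c k := by
      intro k
      simpa using (hTL k x₀ x₀ (fun _ _ => rfl)).1 hx₀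
    have hCk : ∀ k, c k + γ k * (d k - c k) ≤ C := fun k => hC.2 ⟨k, rfl⟩
    have hC0 : 0 ≤ C := by
      refine le_trans ?_ (hCk 0)
      have := hc0 0
      have := (hγ0 0).le
      have := sub_nonneg.2 (hcd 0)
      positivity
    set V := ∑ k, p k * (c k + γ k * (d k - c k) / (1 - p k)) ^ 2 with hV
    have hV0 : 0 ≤ V := Finset.sum_nonneg fun k _ => mul_nonneg (hp0 k) (sq_nonneg _)
    have hBk : ∀ k, MeasurableSet {x | ENNReal.ofReal (γ k) ≤ TBD.A P Γ k x} := fun k =>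
      measurableSet_le measurable_const (TBD.measurable_A P hΓ k)
    set B : Set (∀ k, Λ k) :=
      Γᶜ ∪ ⋃ k : Fin n, {x | ENNReal.ofReal (γ k.succ) ≤ TBD.A P Γ k.succ x} with hB
    have hBm : MeasurableSet B := hΓ.compl.union (MeasurableSet.iUnion fun k => hBk _)
    refine ⟨B, hBm, ?_, ?_, ?_⟩
    · rw [Fin.sum_univ_succ]
      refine (measure_union_le _ _).trans (add_le_add ?_ ?_)
      · exact le_mul_of_one_le_left zero_le (hone 0)
      · refine (measure_iUnion_fintype_le _ _).trans (Finset.sum_le_sum fun k _ => ?_)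
        have hmk := mul_meas_ge_le_lintegral (μ := Measure.pi P) (TBD.measurable_A P hΓ k.succ)
          (ENNReal.ofReal (γ k.succ))
        rw [TBD.lintegral_A P hΓ] at hmk
        calc _ = ENNReal.ofReal ((γ k.succ)⁻¹) * (ENNReal.ofReal (γ k.succ) *
              Measure.pi P {x | ENNReal.ofReal (γ k.succ) ≤ TBD.A P Γ k.succ x}) := by
              rw [← mul_assoc, ← ENNReal.ofReal_mul (inv_nonneg.2 (hγ0 _).le),
                inv_mul_cancel₀ (hγ0 _).ne']
              simp
          _ ≤ _ := by gcongr
    · intro x hx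
      by_contra h
      exact hx (Or.inl h)
    · intro t ht
      by_cases hden : 2 * V + 2 * C * t / 3 = 0
      · rw [hden]
        simpa using prob_le_one
      obtain ⟨l, hl, hlC, hopt⟩ := TBD.optimize hV0 hC0 ht hden
      have hmgf := TBD.mgf (n + 1) P p hp0 hp1 hp f hf M hM Γ hΓ c d hcd hc0 hTL γ
        (fun k => (hγ0 k).le) C hCk l hl hlC Bᶜ hBm.compl (by
          intro x hx k
          refine Fin.cases ?_ (fun k => ?_) k
          · rw [TBD.A_zero]; exact hbig
          · by_contra hk
            exact hx (Or.inr (Set.mem_iUnion.2 ⟨k, not_lt.1 hk⟩)))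
      set m := ∫ y, f y ∂(Measure.pi P) with hm
      set S : Set (∀ k, Λ k) := {x | f x ≥ m + t ∧ x ∉ B} with hS
      have hSm : MeasurableSet S := (measurableSet_le measurable_const hf).inter hBm.compl
      calc Measure.pi P S = ∫⁻ x, S.indicator 1 x ∂(Measure.pi P) := by
            rw [lintegral_indicator_one hSm]
        _ ≤ ∫⁻ x, ENNReal.ofReal (Real.exp (-(l * t))) * Bᶜ.indicator
            (fun x => ENNReal.ofReal (Real.exp (l * (f x - m)))) x ∂(Measure.pi P) := by
            apply lintegral_mono
            intro x
            by_cases hx : x ∈ S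
            · have hxB : x ∈ Bᶜ := hx.2
              have hxf : m + t ≤ f x := hx.1
              simp only [Set.indicator_of_mem hx, Set.indicator_of_mem hxB, Pi.one_apply]
              rw [← ENNReal.ofReal_mul (Real.exp_pos _).le, ← Real.exp_add, ENNReal.one_le_ofReal,
                Real.one_le_exp_iff]
              nlinarith [mul_nonneg hl (show 0 ≤ f x - m - t by linarith)]
            · simp [Set.indicator_of_notMem hx]
        _ = ENNReal.ofReal (Real.exp (-(l * t))) * ∫⁻ x, Bᶜ.indicator
            (fun x => ENNReal.ofReal (Real.exp (l * (f x - m)))) x ∂(Measure.pi P) := by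
            rw [lintegral_const_mul]
            apply Measurable.indicator _ hBm.compl
            fun_prop
        _ ≤ ENNReal.ofReal (Real.exp (-(l * t))) *
            ENNReal.ofReal (Real.exp (l ^ 2 / (2 * (1 - l * C / 3)) * V)) := by gcongr
        _ ≤ _ := by
            rw [← ENNReal.ofReal_mul (Real.exp_pos _).le, ← Real.exp_add]
            exact ENNReal.ofReal_le_ofReal (Real.exp_le_exp.2 hopt)
end

section
/- General bounded differences inequality for asymmetric variables. Let X=(X_1,...,X_N) be a family of random variables with X_k taking values in Λ_k and max_{η∈Λ_k} P(X_k = η | X_1,...,X_{k−1}) ≥ 1 − p_k almost surely. Let Γ be an event in the product space and assume f satisfies the general Lipschitz condition (GL) relative to Γ with coefficients c_k ≤ d_k. Then for any (γ_k)_{k∈[N]} with γ_k ∈ (0,1] there exists an event B = B(Γ,(γ_k)) with P(B) ≤ Σ_{k∈[N]} γ_k^{-1}·P(X ∉ Γ) and complement contained in Γ, such that, setting μ = E f(X), e_k = γ_k(d_k − c_k) and C = max_{k∈[N]} (c_k + e_k), for every t ≥ 0 one has P(f(X) ≥ μ + t and not B) ≤ exp(−t² / (2 Σ_{k∈[N]}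 p_k(c_k + e_k·(1−p_k)^{-1})² + 2Ct/3)). -/
open scoped ENNReal

/-- The probability that `X ∈ E`, for a discrete random variable `X` with law `μ`. -/
noncomputable def prOf {α : Type*} (μ : PMF α) (E : Set α) : ℝ≥0∞ :=
  ∑' x : E, μ x

/-- `Σ_z` of the general Lipschitz condition (GL): all sample points `x` that agree with
`x₀` on the first `k` coordinates, have `k`-th coordinate `z`, and satisfy
`P(X = x) > 0`. -/
def cylSet {N : ℕ} {Λ : Fin N → Type*} (μ : PMF (∀ j, Λ j)) (k : Fin N)
    (x₀ : ∀ j, Λ j) (z : Λ k) : Set (∀ j, Λ j) :=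
  {x | (∀ j : Fin N, (j : ℕ) < (k : ℕ) → x j = x₀ j) ∧ x k = z ∧ 0 < μ x}

/-- The event that `X_1, …, X_k` agree with `x₀`. -/
def prefixSet {N : ℕ} {Λ : Fin N → Type*} (k : Fin N) (x₀ : ∀ j, Λ j) :
    Set (∀ j, Λ j) :=
  {x | ∀ j : Fin N, (j : ℕ) < (k : ℕ) → x j = x₀ j}

namespace GBD

/-- expectation w.r.t. a weight -/
noncomputable def ex {α : Type*} (w : α → ℝ) (g : α → ℝ) : ℝ := ∑' x, w x * g x

/-- probability weight -/
def PW {α : Type*} (w : α → ℝ) : Prop := (∀ x, 0 ≤ w x) ∧ HasSum w 1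

/-- bounded function -/
def Bd {α : Type*} (g : α → ℝ) : Prop := ∃ M : ℝ, ∀ x, |g x| ≤ M

section basic
variable {α : Type*} {w : α → ℝ} {g h : α → ℝ}

lemma Bd.const (c : ℝ) : Bd (fun _ : α => c) := ⟨|c|, fun _ => le_rfl⟩

lemma Bd.add (hg : Bd g) (hh : Bd h) : Bd (fun x => g x + h x) := by
  obtain ⟨M, hM⟩ := hg
  obtain ⟨L, hL⟩ := hh
  exact ⟨M + L, fun x => (abs_add_le _ _).trans (add_le_add (hM x) (hL x))⟩

lemma Bd.mul (hg : Bd g) (hh : Bd h) : Bd (fun x => g x * h x) := by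
  obtain ⟨M, hM⟩ := hg
  obtain ⟨L, hL⟩ := hh
  refine ⟨M * L, fun x => ?_⟩
  rw [abs_mul]
  exact mul_le_mul (hM x) (hL x) (abs_nonneg _) ((abs_nonneg _).trans (hM x))

lemma Bd.neg (hg : Bd g) : Bd (fun x => - g x) := by
  obtain ⟨M, hM⟩ := hg
  exact ⟨M, fun x => by rw [abs_neg]; exact hM x⟩

lemma Bd.sub (hg : Bd g) (hh : Bd h) : Bd (fun x => g x - h x) := by
  simpa [sub_eq_add_neg] using hg.add hh.neg

lemma Bd.exp (hg : Bd g) : Bd (fun x => Real.exp (g x)) := by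
  obtain ⟨M, hM⟩ := hg
  refine ⟨Real.exp M, fun x => ?_⟩
  rw [abs_of_pos (Real.exp_pos _)]
  exact Real.exp_le_exp.2 ((le_abs_self _).trans (hM x))

lemma Bd.ind (E : Set α) : Bd (E.indicator (fun _ => (1 : ℝ))) := by
  refine ⟨1, fun x => ?_⟩
  by_cases hx : x ∈ E <;> simp [hx]

lemma Bd.ite (P : α → Prop) [DecidablePred P] (hg : Bd g) (hh : Bd h) :
    Bd (fun x => if P x then g x else h x) := by
  obtain ⟨M, hM⟩ := hg
  obtain ⟨L, hL⟩ := hh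
  refine ⟨max M L, fun x => ?_⟩
  dsimp only
  split_ifs
  · exact (hM x).trans (le_max_left _ _)
  · exact (hL x).trans (le_max_right _ _)

lemma Bd.sum {ι : Type*} (s : Finset ι) (G : ι → α → ℝ) (hG : ∀ i, Bd (G i)) :
    Bd (fun x => ∑ i ∈ s, G i x) := by
  classical
  induction s using Finset.induction_on with
  | empty => simpa using Bd.const (α := α) 0
  | insert a s ha ih => 
    simp only [Finset.sum_insert ha]
    exact (hG a).add ih

lemma PW.smul (hw : PW w) (hg : Bd g) : Summable (fun x => w x * g x) := by
  obtain ⟨M, hM⟩ := hg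
  refine Summable.of_norm_bounded (g := fun x => w x * M) (hw.2.summable.mul_right M) fun x => ?_
  rw [Real.norm_eq_abs, abs_mul, abs_of_nonneg (hw.1 x)]
  exact mul_le_mul_of_nonneg_left (hM x) (hw.1 x)

lemma PW.ex_const (hw : PW w) (c : ℝ) : ex w (fun _ => c) = c := by
  simp [ex, tsum_mul_right, hw.2.tsum_eq]

lemma PW.ex_add (hw : PW w) (hg : Bd g) (hh : Bd h) :
    ex w (fun x => g x + h x) = ex w g + ex w h := by
  simp only [ex, mul_add]
  exact (hw.smul hg).tsum_add (hw.smul hh)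

lemma PW.ex_sub (hw : PW w) (hg : Bd g) (hh : Bd h) :
    ex w (fun x => g x - h x) = ex w g - ex w h := by
  simp only [ex, mul_sub]
  exact (hw.smul hg).tsum_sub (hw.smul hh)

lemma ex_smul (c : ℝ) : ex w (fun x => c * g x) = c * ex w g := by
  simp only [ex, ← tsum_mul_left]
  congr 1; ext x; ring

lemma ex_neg : ex w (fun x => - g x) = - ex w g := by
  simp only [ex, ← tsum_neg]
  congr 1; ext x; ring

lemma PW.ex_mono (hw : PW w) (hg : Bd g) (hh : Bd h) (hgh : ∀ x, 0 < w x → g x ≤ h x) :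
    ex w g ≤ ex w h := by
  refine (hw.smul hg).tsum_le_tsum (fun x => ?_) (hw.smul hh)
  rcases (hw.1 x).eq_or_lt with h0 | h0
  · simp [← h0]
  · exact mul_le_mul_of_nonneg_left (hgh x h0) h0.le

lemma ex_congr (hgh : ∀ x, w x ≠ 0 → g x = h x) :
    ex w g = ex w h := by
  unfold ex
  congr 1; ext x
  by_cases h0 : w x = 0
  · simp [h0]
  · rw [hgh x h0]

lemma exp_ineq {x b : ℝ} (hxb : x ≤ b) (hb : b < 3) :
    Real.exp x ≤ 1 + x + x ^ 2 / (2 * (1 - b / 3)) := by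
  -- first derivative sign
  have key : ∀ x : ℝ, 0 ≤ x ^ 2 / 2 - (1 - x / 3) * (Real.exp x - 1 - x) := by
    set h : ℝ → ℝ := fun x => x ^ 2 / 2 - (1 - x / 3) * (Real.exp x - 1 - x) with hh
    set h1 : ℝ → ℝ := fun x => x + (1/3) * (Real.exp x - 1 - x) - (1 - x/3) * (Real.exp x - 1)
      with hh1
    have d0 : ∀ x, HasDerivAt h (h1 x) x := by
      intro x
      have := (((hasDerivAt_id x).pow 2).div_const 2).sub
        ((((hasDerivAt_id x).div_const 3).const_sub 1).mul
          (((Real.hasDerivAt_exp x).sub_const 1).sub (hasDerivAt_id x)))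
      refine this.congr_deriv ?_
      simp [hh1]; ring
    have d1 : ∀ x, HasDerivAt h1 ((1/3) * (1 - (1 - x) * Real.exp x)) x := by
      intro x
      have := ((hasDerivAt_id x).add
        ((((Real.hasDerivAt_exp x).sub_const 1).sub (hasDerivAt_id x)).const_mul (1/3))).sub
        ((((hasDerivAt_id x).div_const 3).const_sub 1).mul
          ((Real.hasDerivAt_exp x).sub_const 1))
      refine this.congr_deriv ?_
      simp; ring
    have p1 : ∀ x : ℝ, 0 ≤ (1/3) * (1 - (1 - x) * Real.exp x) := by
      intro x
      have e1 : 1 - x ≤ Real.exp (-x) := by linarith [Real.add_one_le_exp (-x)]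
      have e2 : (1 - x) * Real.exp x ≤ Real.exp (-x) * Real.exp x :=
        mul_le_mul_of_nonneg_right e1 (Real.exp_pos _).le
      rw [← Real.exp_add] at e2
      simp at e2
      linarith
    have m1 : Monotone h1 := monotone_of_hasDerivAt_nonneg d1 p1
    have z1 : h1 0 = 0 := by simp [hh1]
    have z0 : h 0 = 0 := by simp [hh]
    intro x
    change 0 ≤ h x
    have hc : Continuous h := by
      rw [continuous_iff_continuousAt]; exact fun x => (d0 x).continuousAt
    rcases le_total 0 x with hx | hx
    · have : MonotoneOn h (Set.Ici 0) := by
        refine monotoneOn_of_deriv_nonneg (convex_Ici 0) hc.continuousOn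
          (fun y _ => (d0 y).differentiableAt.differentiableWithinAt) fun y hy => ?_
        rw [(d0 y).deriv, ← z1]
        exact m1 (interior_subset hy)
      rw [← z0]; exact this (by simp) hx hx
    · have : AntitoneOn h (Set.Iic 0) := by
        refine antitoneOn_of_deriv_nonpos (convex_Iic 0) hc.continuousOn
          (fun y _ => (d0 y).differentiableAt.differentiableWithinAt) fun y hy => ?_
        rw [(d0 y).deriv, ← z1]
        have hy' : y ∈ Set.Iic (0 : ℝ) := interior_subset hy
        exact m1 hy'
      rw [← z0]; exact this hx (by simp) hx
  have k := key x
  have h1 : 0 < 1 - b / 3 := by linarith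
  have h2 : 1 - b / 3 ≤ 1 - x / 3 := by linarith
  have h3 : 0 ≤ Real.exp x - 1 - x := by linarith [Real.add_one_le_exp x]
  have h4 : Real.exp x - 1 - x ≤ x ^ 2 / (2 * (1 - b / 3)) := by
    rw [le_div_iff₀ (by positivity)]
    nlinarith [mul_le_mul_of_nonneg_right h2 h3]
  linarith

lemma onestep (hw : PW w) (hg : Bd g) {l C v : ℝ} (hl : 0 ≤ l) (hC : l * C < 3)
    (h1 : ∀ y, 0 < w y → g y - ex w g ≤ C)
    (h2 : ex w (fun y => (g y - ex w g) * (g y - ex w g)) ≤ v) :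
    ex w (fun y => Real.exp (l * (g y - ex w g))) ≤
      Real.exp (l ^ 2 * v / (2 * (1 - l * C / 3))) := by
  set m := ex w g with hm
  have hD : Bd (fun y => g y - m) := hg.sub (Bd.const m)
  have hK : 0 < 2 * (1 - l * C / 3) := by linarith
  set K := l ^ 2 / (2 * (1 - l * C / 3)) with hKdef
  have hK0 : 0 ≤ K := by positivity
  have b1 : Bd (fun y => l * (g y - m)) := (Bd.const l).mul hD
  have b2 : Bd (fun y => K * ((g y - m) * (g y - m))) := (Bd.const K).mul (hD.mul hD)
  calc ex w (fun y => Real.exp (l * (g y - m)))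
      ≤ ex w (fun y => (1 + l * (g y - m)) + K * ((g y - m) * (g y - m))) := by
        refine hw.ex_mono b1.exp (((Bd.const 1).add b1).add b2) fun y hy => ?_
        have := exp_ineq (x := l * (g y - m)) (b := l * C)
          (mul_le_mul_of_nonneg_left (h1 y hy) hl) hC
        refine this.trans (le_of_eq ?_)
        rw [hKdef]; ring
    _ = 1 + K * ex w (fun y => (g y - m) * (g y - m)) := by
        rw [hw.ex_add ((Bd.const 1).add b1) b2, hw.ex_add (Bd.const 1) b1, hw.ex_const, ex_smul,
          ex_smul, hw.ex_sub hg (Bd.const m), hw.ex_const, ← hm]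
        ring
    _ ≤ 1 + K * v := by gcongr
    _ ≤ Real.exp (K * v) := by linarith [Real.add_one_le_exp (K * v)]
    _ = _ := by rw [hKdef]; congr 1; ring

lemma upper_of (hw : PW w) (hg : Bd g) {q : α → ℝ} (hq : Bd q) {c e γ : ℝ} (he : 0 ≤ e)
    (hqγ : ex w q ≤ γ)
    (H : ∀ y z, 0 < w y → 0 < w z → g y - g z ≤ c + e * q z) (y : α) (hy : 0 < w y) :
    g y - ex w g ≤ c + γ * e := by
  have : ex w (fun z => g y - g z) ≤ ex w (fun z => c + e * q z) :=
    hw.ex_mono ((Bd.const _).sub hg) ((Bd.const _).add ((Bd.const _).mul hq))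
      fun z hz => H y z hy hz
  rw [hw.ex_sub (Bd.const _) hg, hw.ex_const, hw.ex_add (Bd.const _) ((Bd.const _).mul hq),
    hw.ex_const, ex_smul] at this
  nlinarith

lemma var_of (hw : PW w) (hg : Bd g) {G s p : ℝ} (T : Set α)
    (hT : ∀ y ∈ T, g y = G) (hTp : 1 - p ≤ ex w (T.indicator fun _ => 1))
    (H : ∀ y, 0 < w y → |g y - G| ≤ s) :
    ex w (fun y => (g y - ex w g) * (g y - ex w g)) ≤ p * s ^ 2 := by
  set m := ex w g with hm
  have b0 : Bd (fun y => (g y - G)) := hg.sub (Bd.const _)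
  have b1 : Bd (fun y => (g y - G) * (g y - G)) := b0.mul b0
  have e1 : ex w (fun y => (g y - m) * (g y - m)) =
      ex w (fun y => (g y - G) * (g y - G)) - (m - G) ^ 2 := by
    have : (fun y => (g y - m) * (g y - m)) =
        fun y => ((g y - G) * (g y - G) - (2 * (m - G)) * (g y - G)) + (m - G) ^ 2 := by
      ext y; ring
    rw [this, hw.ex_add (b1.sub ((Bd.const _).mul b0)) (Bd.const _), hw.ex_const,
      hw.ex_sub b1 ((Bd.const _).mul b0), ex_smul, hw.ex_sub hg (Bd.const _), hw.ex_const, ← hm]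
    ring
  have e2 : ex w (fun y => (g y - G) * (g y - G)) ≤
      ex w (fun y => s ^ 2 * (1 - T.indicator (fun _ => 1) y)) := by
    refine hw.ex_mono b1 ((Bd.const _).mul ((Bd.const _).sub (Bd.ind T))) fun y hy => ?_
    by_cases hyT : y ∈ T
    · simp [hyT, hT y hyT]
    · have := H y hy
      have h3 := sq_le_sq' (by linarith [abs_nonneg (g y - G)]) this
      rw [sq_abs] at h3
      simp [hyT]; nlinarith
  rw [ex_smul, hw.ex_sub (Bd.const _) (Bd.ind T), hw.ex_const] at e2
  nlinarith [sq_nonneg (m - G), mul_le_mul_of_nonneg_left hTp (sq_nonneg s)]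

lemma transport {w₁ w₂ : α → ℝ} (h₁ : PW w₁) (h₂ : PW w₂) {f r : α → ℝ} (hf : Bd f) (hr : Bd r)
    (ρ : α → α) (hinj : Set.InjOn ρ {z | 0 < w₁ z})
    (hle : ∀ z, 0 < w₁ z → w₁ z ≤ w₂ (ρ z))
    (hfr : ∀ z, 0 < w₁ z → f z - f (ρ z) ≤ r z) :
    ex w₁ f ≤ ex w₂ f + ex w₁ r := by
  obtain ⟨M, hM⟩ := id hf
  have e2 : ex w₂ (fun x => f x + M) = ex w₂ f + M := by
    rw [h₂.ex_add hf (Bd.const M), h₂.ex_const]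
  have bS : Bd (fun x => f x - r x + M) := (hf.sub hr).add (Bd.const M)
  have e1 : ex w₁ (fun x => f x - r x + M) = ex w₁ f - ex w₁ r + M := by
    rw [h₁.ex_add (hf.sub hr) (Bd.const M), h₁.ex_const, h₁.ex_sub hf hr]
  have sub : ex w₁ (fun x => f x - r x + M) =
      ∑' z : {z | 0 < w₁ z}, w₁ z * (f z - r z + M) := by
    unfold ex
    refine (tsum_subtype_eq_of_support_subset (f := fun z => w₁ z * (f z - r z + M)) ?_).symm
    intro z hz
    have : w₁ z ≠ 0 := by
      intro h0; simp [h0] at hz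
    exact lt_of_le_of_ne (h₁.1 z) (Ne.symm this)
  have main : ∑' z : {z | 0 < w₁ z}, w₁ z * (f z - r z + M) ≤ ex w₂ (fun x => f x + M) := by
    unfold ex
    refine Summable.tsum_le_tsum_of_inj (fun z : {z | 0 < w₁ z} => ρ z) ?_ ?_ ?_ ?_ ?_
    · intro a b hab
      exact Subtype.ext (hinj a.2 b.2 hab)
    · intro x _
      have := (abs_le.1 (hM x)).1
      exact mul_nonneg (h₂.1 x) (by linarith)
    · intro z
      have a1 := hfr z z.2
      have a2 := hle z z.2
      have a3 := (abs_le.1 (hM (ρ z))).1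
      have a4 := h₁.1 z
      calc w₁ z * (f z - r z + M) ≤ w₁ z * (f (ρ z) + M) :=
            mul_le_mul_of_nonneg_left (by linarith) a4
        _ ≤ w₂ (ρ z) * (f (ρ z) + M) := mul_le_mul_of_nonneg_right a2 (by linarith)
    · exact (h₁.smul bS).subtype _
    · exact h₂.smul (hf.add (Bd.const M))
  linarith

end basic

section cond
variable {α β : Type*} {w : α → ℝ}

/-- mass of the cell of `x` -/
noncomputable def mass (w : α → ℝ) (π : α → β) (x : α) : ℝ :=
  ∑' z, Set.indicator {z | π z = π x} w z

/-- conditional weight -/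
noncomputable def cw (w : α → ℝ) (π : α → β) (x : α) (y : α) : ℝ :=
  Set.indicator {z | π z = π x} w y / mass w π x

/-- conditional expectation -/
noncomputable def CE (w : α → ℝ) (π : α → β) (g : α → ℝ) (x : α) : ℝ := ex (cw w π x) g

lemma PW.ind_summable (hw : PW w) (E : Set α) : Summable (E.indicator w) :=
  hw.2.summable.indicator E

lemma mass_pos (hw : PW w) (π : α → β) {x : α} (hx : 0 < w x) : 0 < mass w π x := by
  refine (hw.ind_summable _).tsum_pos (fun i => Set.indicator_nonneg (fun i _ => hw.1 i) i) x ?_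
  simpa using hx

lemma mass_nonneg (hw : PW w) (π : α → β) (x : α) : 0 ≤ mass w π x :=
  tsum_nonneg (fun i => Set.indicator_nonneg (fun i _ => hw.1 i) i)

lemma cw_pw (hw : PW w) (π : α → β) {x : α} (hx : 0 < w x) : PW (cw w π x) := by
  constructor
  · intro y
    exact div_nonneg (Set.indicator_nonneg (fun i _ => hw.1 i) y) (mass_nonneg hw π x)
  · have := (hw.ind_summable {z | π z = π x}).hasSum.div_const (mass w π x)
    change HasSum _ (mass w π x / mass w π x) at this
    rwa [div_self (mass_pos hw π hx).ne'] at this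

lemma cw_pos (hw : PW w) (π : α → β) {x y : α} (hx : 0 < w x) :
    0 < cw w π x y ↔ π y = π x ∧ 0 < w y := by
  unfold cw
  rw [div_pos_iff_of_pos_right (mass_pos hw π hx)]
  by_cases h : π y = π x <;> simp [h]

lemma cw_congr (π : α → β) {x y : α} (h : π x = π y) : cw w π x = cw w π y := by
  unfold cw mass; rw [h]

lemma CE_congr (π : α → β) {g : α → ℝ} {x y : α} (h : π x = π y) : CE w π g x = CE w π g y := by
  unfold CE; rw [cw_congr π h]

lemma CE_bd (hw : PW w) (π : α → β) {g : α → ℝ} (hg : Bd g) : Bd (CE w π g) := by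
  obtain ⟨M, hM⟩ := id hg
  refine ⟨max M 0, fun x => ?_⟩
  by_cases hm : mass w π x = 0
  · have : CE w π g x = 0 := by simp [CE, ex, cw, hm]
    rw [this]; simp
  · have hpw : PW (cw w π x) := by
      constructor
      · intro y
        exact div_nonneg (Set.indicator_nonneg (fun i _ => hw.1 i) y) (mass_nonneg hw π x)
      · have := (hw.ind_summable {z | π z = π x}).hasSum.div_const (mass w π x)
        change HasSum _ (mass w π x / mass w π x) at this
        rwa [div_self hm] at this
    refine le_trans ?_ (le_max_left _ _)
    rw [abs_le]
    constructor
    · rw [← hpw.ex_const (-M)]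
      exact hpw.ex_mono (Bd.const _) hg fun y _ => (abs_le.1 (hM y)).1
    · conv_rhs => rw [← hpw.ex_const M]
      exact hpw.ex_mono hg (Bd.const _) fun y _ => (abs_le.1 (hM y)).2

lemma CE_mul_mass (hw : PW w) (π : α → β) {g : α → ℝ} {x : α} (hx : 0 < w x) :
    mass w π x * CE w π g x = ex w (fun y => Set.indicator {z | π z = π x} (fun _ => 1) y * g y) := by
  have hm := (mass_pos hw π hx).ne'
  simp only [CE, ex, ← tsum_mul_left]
  congr 1; ext y
  unfold cw
  by_cases h : π y = π x
  · simp [h]; field_simp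
  · simp [h]

lemma tower (hw : PW w) (π : α → β) {u v : α → ℝ} (hu : Bd u) (hv : Bd v)
    (hπ : ∀ x y, π x = π y → u x = u y) :
    ex w (fun x => u x * CE w π v x) = ex w (fun x => u x * v x) := by
  have s1 := hw.smul (hu.mul (CE_bd hw π hv))
  have s2 := hw.smul (hu.mul hv)
  have t1 := (s1.hasSum.tsum_fiberwise π).tsum_eq
  have t2 := (s2.hasSum.tsum_fiberwise π).tsum_eq
  unfold ex
  rw [← t1, ← t2]
  congr 1; ext b
  by_cases hb : ∃ x, π x = b ∧ 0 < w x
  · obtain ⟨x, rfl, hx⟩ := hb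
    have hm := (mass_pos hw π hx).ne'
    have a1 : ∀ z : π ⁻¹' {π x}, w z * (u z * CE w π v z) = w z * (u x * CE w π v x) := by
      intro z
      have hz : π z = π x := z.2
      rw [hπ _ _ hz, CE_congr π hz]
    have a2 : ∀ z : π ⁻¹' {π x}, w z * (u z * v z) = u x * (w z * v z) := by
      intro z
      have hz : π z = π x := z.2
      rw [hπ _ _ hz]; ring
    rw [tsum_congr a1, tsum_congr a2, tsum_mul_right, tsum_mul_left]
    have b1 : ∑' z : π ⁻¹' {π x}, w z = mass w π x := by
      rw [tsum_subtype (π ⁻¹' {π x}) w]; rfl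
    have b2 : ∑' z : π ⁻¹' {π x}, w z * v z = mass w π x * CE w π v x := by
      rw [CE_mul_mass hw π hx, tsum_subtype (π ⁻¹' {π x}) (fun z => w z * v z)]
      unfold ex
      congr 1; ext z
      by_cases h : π z = π x <;> simp [h]
    rw [b1, b2]; ring
  · have : ∀ z : π ⁻¹' {b}, w z = 0 := by
      intro z
      by_contra h0
      exact hb ⟨z, z.2, lt_of_le_of_ne (hw.1 z) (Ne.symm h0)⟩
    simp [this]

lemma ex_CE (hw : PW w) (π : α → β) {v : α → ℝ} (hv : Bd v) : ex w (CE w π v) = ex w v := by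
  simpa using tower hw π (u := fun _ => 1) (Bd.const 1) hv (fun _ _ _ => rfl)

lemma CE_CE {β' : Type*} (hw : PW w) (π : α → β) (π' : α → β')
    (hππ : ∀ x y, π' x = π' y → π x = π y) {v : α → ℝ} (hv : Bd v) {x : α} (hx : 0 < w x) :
    CE w π (CE w π' v) x = CE w π v x := by
  have hm := (mass_pos hw π hx).ne'
  refine mul_left_cancel₀ hm ?_
  rw [CE_mul_mass hw π hx, CE_mul_mass hw π hx]
  refine tower hw π' (Bd.ind _) hv ?_
  intro a b hab
  have := hππ _ _ hab
  by_cases h : π b = π x <;> simp [h, this]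

end cond
end GBD

namespace GBD
section main

lemma PW.ex_sum {α : Type*} {w : α → ℝ} (hw : PW w) {ι : Type*} (s : Finset ι) (G : ι → α → ℝ)
    (hG : ∀ i, Bd (G i)) : ex w (fun x => ∑ i ∈ s, G i x) = ∑ i ∈ s, ex w (G i) := by
  classical
  induction s using Finset.induction_on with
  | empty => simp [ex]
  | insert a s ha ih =>
    simp only [Finset.sum_insert ha]
    rw [hw.ex_add (hG a) (Bd.sum s G hG), ih]

/-- real weight of a PMF -/
noncomputable def Wt {α : Type*} (μ : PMF α) (x : α) : ℝ := (μ x).toReal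

lemma Wt_pw {α : Type*} (μ : PMF α) : PW (Wt μ) := by
  refine ⟨fun x => ENNReal.toReal_nonneg, ?_⟩
  have h := ENNReal.tsum_toReal_eq (f := fun x => μ x) (fun x => μ.apply_ne_top x)
  have hs : Summable (Wt μ) := ENNReal.summable_toReal (by rw [μ.tsum_coe]; simp)
  have := hs.hasSum
  have e : ∑' x, Wt μ x = 1 := by
    change ∑' x, (μ x).toReal = 1
    rw [← h, μ.tsum_coe]; simp
  rwa [e] at this

lemma Wt_pos {α : Type*} (μ : PMF α) (x : α) : 0 < Wt μ x ↔ 0 < μ x := by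
  unfold Wt
  rw [ENNReal.toReal_pos_iff]
  exact ⟨fun h => h.1, fun h => ⟨h, lt_top_iff_ne_top.2 (μ.apply_ne_top x)⟩⟩

lemma ex_ind {α : Type*} (w : α → ℝ) (E : Set α) :
    ex w (E.indicator fun _ => 1) = ∑' x, E.indicator w x := by
  unfold ex
  congr 1; ext x
  by_cases h : x ∈ E <;> simp [h]

lemma prOf_le_one {α : Type*} (μ : PMF α) (E : Set α) : prOf μ E ≤ 1 := by
  unfold prOf
  rw [← μ.tsum_coe]
  exact ENNReal.tsum_comp_le_tsum_of_injective Subtype.val_injective _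

lemma prOf_toReal {α : Type*} (μ : PMF α) (E : Set α) :
    (prOf μ E).toReal = ex (Wt μ) (E.indicator fun _ => 1) := by
  rw [ex_ind, ← tsum_subtype]
  unfold prOf
  exact ENNReal.tsum_toReal_eq (fun x => μ.apply_ne_top x)

lemma prOf_ne_top {α : Type*} (μ : PMF α) (E : Set α) : prOf μ E ≠ ⊤ :=
  ne_top_of_le_ne_top ENNReal.one_ne_top (prOf_le_one μ E)

lemma prOf_eq {α : Type*} (μ : PMF α) (E : Set α) :
    prOf μ E = ENNReal.ofReal (ex (Wt μ) (E.indicator fun _ => 1)) := by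
  rw [← prOf_toReal, ENNReal.ofReal_toReal (prOf_ne_top μ E)]

variable {N : ℕ} {Λ : Fin N → Type*}

/-- projection to the first `n` coordinates -/
def pre (n : ℕ) (x : ∀ j, Λ j) : ∀ j, Option (Λ j) :=
  fun j => if (j : ℕ) < n then some (x j) else none

lemma pre_eq {n : ℕ} {x y : ∀ j, Λ j} :
    pre n x = pre n y ↔ ∀ j : Fin N, (j : ℕ) < n → x j = y j := by
  constructor
  · intro h j hj
    have := congrFun h j
    simpa [pre, hj] using this
  · intro h
    ext1 j
    by_cases hj : (j : ℕ) < n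
    · simp [pre, hj, h j hj]
    · simp [pre, hj]

lemma pre_succ {k : Fin N} {x y : ∀ j, Λ j} :
    pre ((k : ℕ) + 1) x = pre ((k : ℕ) + 1) y ↔ pre (k : ℕ) x = pre (k : ℕ) y ∧ x k = y k := by
  rw [pre_eq, pre_eq]
  constructor
  · intro h
    exact ⟨fun j hj => h j (by omega), h k (by omega)⟩
  · rintro ⟨h1, h2⟩ j hj
    rcases Nat.lt_succ_iff_lt_or_eq.1 hj with h | h
    · exact h1 j h
    · have : j = k := Fin.ext h
      rw [this]; exact h2

lemma mem_cyl (μ : PMF (∀ j, Λ j)) {k : Fin N} {x₀ y z : ∀ j, Λ j}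
    (h : pre (k : ℕ) y = pre (k : ℕ) x₀) :
    z ∈ cylSet μ k x₀ (y k) ↔ pre ((k : ℕ) + 1) z = pre ((k : ℕ) + 1) y ∧ 0 < Wt μ z := by
  rw [pre_succ, h, pre_eq, Wt_pos]
  simp only [cylSet, Set.mem_ofPred_eq]
  tauto

lemma prOf_cyl (μ : PMF (∀ j, Λ j)) {k : Fin N} {x₀ y : ∀ j, Λ j}
    (h : pre (k : ℕ) y = pre (k : ℕ) x₀) :
    (prOf μ (cylSet μ k x₀ (y k))).toReal = mass (Wt μ) (pre ((k : ℕ) + 1)) y := by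
  rw [prOf_toReal, ex_ind]
  unfold mass
  congr 1; ext z
  by_cases h1 : pre ((k : ℕ) + 1) z = pre ((k : ℕ) + 1) y
  · by_cases h2 : 0 < Wt μ z
    · rw [Set.indicator_of_mem ((mem_cyl μ h).2 ⟨h1, h2⟩), Set.indicator_of_mem (by exact h1)]
    · have : Wt μ z = 0 := le_antisymm (not_lt.1 h2) ((Wt_pw μ).1 z)
      rw [Set.indicator_apply_eq_zero.2 (fun _ => this), Set.indicator_apply_eq_zero.2 (fun _ => this)]
  · rw [Set.indicator_of_notMem (fun hh => h1 ((mem_cyl μ h).1 hh).1),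
      Set.indicator_of_notMem (by exact h1)]

/-- one-sided consequence of (GL) -/
lemma gl_step (μ : PMF (∀ j, Λ j)) (f : (∀ j, Λ j) → ℝ) (hf : Bd f) (Γ : Set (∀ j, Λ j))
    (c d : ℝ) (k : Fin N)
    (hGL : ∀ (x₀ : ∀ j, Λ j) (a b : Λ k),
      (cylSet μ k x₀ a).Nonempty → (cylSet μ k x₀ b).Nonempty →
      ∃ ρ : (∀ j, Λ j) → (∀ j, Λ j),
        Set.MapsTo ρ (cylSet μ k x₀ a) (cylSet μ k x₀ b) ∧
        Set.InjOn ρ (cylSet μ k x₀ a) ∧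
        ∀ x ∈ cylSet μ k x₀ a,
          (x ∈ Γ → |f x - f (ρ x)| ≤ c) ∧
          (x ∉ Γ → |f x - f (ρ x)| ≤ d) ∧
          μ x / prOf μ (cylSet μ k x₀ a) ≤ μ (ρ x) / prOf μ (cylSet μ k x₀ b))
    {x y : ∀ j, Λ j} (hx : 0 < Wt μ x) (hy : 0 < Wt μ y) (hxy : pre (k : ℕ) x = pre (k : ℕ) y) :
    |CE (Wt μ) (pre ((k : ℕ) + 1)) f x - CE (Wt μ) (pre ((k : ℕ) + 1)) f y| ≤
      c + (d - c) * CE (Wt μ) (pre ((k : ℕ) + 1)) (Γᶜ.indicator fun _ => 1) x := by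
  have hw := Wt_pw μ
  have hax : ∀ z, z ∈ cylSet μ k x (x k) ↔ _ := fun z => mem_cyl μ (z := z) (rfl)
  have hby : ∀ z, z ∈ cylSet μ k x (y k) ↔ _ := fun z => mem_cyl μ (z := z) hxy.symm
  obtain ⟨ρ, hmaps, hinj, H⟩ := hGL x (x k) (y k) ⟨x, (hax x).2 ⟨rfl, hx⟩⟩
    ⟨y, (hby y).2 ⟨rfl, hy⟩⟩
  have px := cw_pw hw (pre ((k : ℕ) + 1)) hx
  have py := cw_pw hw (pre ((k : ℕ) + 1)) hy
  have supp : ∀ z, 0 < cw (Wt μ) (pre ((k : ℕ) + 1)) x z → z ∈ cylSet μ k x (x k) := by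
    intro z hz
    exact (hax z).2 ((cw_pos hw _ hx).1 hz)
  have hinj' : Set.InjOn ρ {z | 0 < cw (Wt μ) (pre ((k : ℕ) + 1)) x z} :=
    hinj.mono (fun z hz => supp z hz)
  have hle : ∀ z, 0 < cw (Wt μ) (pre ((k : ℕ) + 1)) x z →
      cw (Wt μ) (pre ((k : ℕ) + 1)) x z ≤ cw (Wt μ) (pre ((k : ℕ) + 1)) y (ρ z) := by
    intro z hz
    have h1 := supp z hz
    have h2 := hmaps h1
    have h3 := (H z h1).2.2
    have hne : prOf μ (cylSet μ k x (y k)) ≠ 0 := by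
      intro h0
      have := prOf_cyl μ (k := k) hxy.symm
      rw [h0] at this
      exact (mass_pos hw (pre ((k : ℕ) + 1)) hy).ne this
    have h4 := ENNReal.toReal_mono (ENNReal.div_ne_top (μ.apply_ne_top _) hne) h3
    rw [ENNReal.toReal_div, ENNReal.toReal_div, prOf_cyl μ hxy.symm, prOf_cyl μ rfl] at h4
    unfold cw
    rw [Set.indicator_of_mem (by exact ((hax z).1 h1).1),
      Set.indicator_of_mem (by exact ((hby _).1 h2).1)]
    exact h4
  have hbd : ∀ z, 0 < cw (Wt μ) (pre ((k : ℕ) + 1)) x z →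
      |f z - f (ρ z)| ≤ c + (d - c) * Γᶜ.indicator (fun _ => 1) z := by
    intro z hz
    have h1 := H z (supp z hz)
    by_cases hzΓ : z ∈ Γ
    · simpa [hzΓ] using h1.1 hzΓ
    · simpa [hzΓ] using h1.2.1 hzΓ
  have br : Bd (fun z => c + (d - c) * Γᶜ.indicator (fun _ => (1 : ℝ)) z) :=
    (Bd.const _).add ((Bd.const _).mul (Bd.ind _))
  have er : ex (cw (Wt μ) (pre ((k : ℕ) + 1)) x)
      (fun z => c + (d - c) * Γᶜ.indicator (fun _ => (1 : ℝ)) z) =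
      c + (d - c) * CE (Wt μ) (pre ((k : ℕ) + 1)) (Γᶜ.indicator fun _ => 1) x := by
    rw [px.ex_add (Bd.const _) ((Bd.const _).mul (Bd.ind _)), px.ex_const, ex_smul]; rfl
  have t1 := transport px py hf br ρ hinj' hle (fun z hz => (abs_le.1 (hbd z hz)).2.trans' le_rfl)
  have t2 := transport px py hf.neg br ρ hinj' hle
    (fun z hz => by have := (abs_le.1 (hbd z hz)).1; linarith)
  rw [er] at t1 t2
  rw [ex_neg, ex_neg] at t2
  unfold CE at *
  rw [abs_le]
  constructor <;> linarith

lemma mstep (μ : PMF (∀ j, Λ j)) (f : (∀ j, Λ j) → ℝ) (hf : Bd f) (Γ : Set (∀ j, Λ j))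
    (c d p γ : ℝ) (hp1 : p < 1) (hcd : c ≤ d) (k : Fin N)
    (hp : ∀ (x₀ : ∀ j, Λ j), 0 < prOf μ (prefixSet k x₀) →
      ∃ η : Λ k, ENNReal.ofReal (1 - p) * prOf μ (prefixSet k x₀) ≤
        prOf μ (prefixSet k x₀ ∩ {x | x k = η}))
    (hGL : ∀ (x₀ : ∀ j, Λ j) (a b : Λ k),
      (cylSet μ k x₀ a).Nonempty → (cylSet μ k x₀ b).Nonempty →
      ∃ ρ : (∀ j, Λ j) → (∀ j, Λ j),
        Set.MapsTo ρ (cylSet μ k x₀ a) (cylSet μ k x₀ b) ∧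
        Set.InjOn ρ (cylSet μ k x₀ a) ∧
        ∀ x ∈ cylSet μ k x₀ a,
          (x ∈ Γ → |f x - f (ρ x)| ≤ c) ∧
          (x ∉ Γ → |f x - f (ρ x)| ≤ d) ∧
          μ x / prOf μ (cylSet μ k x₀ a) ≤ μ (ρ x) / prOf μ (cylSet μ k x₀ b))
    {l C : ℝ} (hl : 0 ≤ l) (hlC : l * C < 3) (hC : c + γ * (d - c) ≤ C)
    {x : ∀ j, Λ j} (hx : 0 < Wt μ x)
    (hq : CE (Wt μ) (pre (k : ℕ)) (Γᶜ.indicator fun _ => 1) x ≤ γ) :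
    CE (Wt μ) (pre (k : ℕ)) (fun y => Real.exp (l * (CE (Wt μ) (pre ((k : ℕ) + 1)) f y -
        CE (Wt μ) (pre (k : ℕ)) f y))) x ≤
      Real.exp (l ^ 2 * (p * (c + γ * (d - c) / (1 - p)) ^ 2) / (2 * (1 - l * C / 3))) := by
  have hw := Wt_pw μ
  set w := Wt μ with hwdef
  set g := CE w (pre ((k : ℕ) + 1)) f with hg
  set q := CE w (pre ((k : ℕ) + 1)) (Γᶜ.indicator fun _ => 1) with hqdef
  have hgb : Bd g := CE_bd hw _ hf
  have hqb : Bd q := CE_bd hw _ (Bd.ind _)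
  have href : ∀ x y : (∀ j, Λ j), pre ((k : ℕ) + 1) x = pre ((k : ℕ) + 1) y →
      pre (k : ℕ) x = pre (k : ℕ) y := fun x y h => (pre_succ.1 h).1
  have pk := cw_pw hw (pre (k : ℕ)) hx
  have eg : ex (cw w (pre (k : ℕ)) x) g = CE w (pre (k : ℕ)) f x :=
    CE_CE hw _ _ href hf hx
  have eq' : ex (cw w (pre (k : ℕ)) x) q = CE w (pre (k : ℕ)) (Γᶜ.indicator fun _ => 1) x :=
    CE_CE hw _ _ href (Bd.ind _) hx
  have gl : ∀ {y z}, 0 < w y → 0 < w z → pre (k : ℕ) y = pre (k : ℕ) z →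
      |g y - g z| ≤ c + (d - c) * q y := fun hy hz hyz => gl_step μ f hf Γ c d k hGL hy hz hyz
  have e1 : CE w (pre (k : ℕ)) (fun y => Real.exp (l * (g y - CE w (pre (k : ℕ)) f y))) x =
      ex (cw w (pre (k : ℕ)) x)
        (fun y => Real.exp (l * (g y - ex (cw w (pre (k : ℕ)) x) g))) := by
    refine ex_congr fun y hy => ?_
    have hy' := (cw_pos hw _ hx).1 (lt_of_le_of_ne (pk.1 y) (Ne.symm hy))
    rw [eg, CE_congr (pre (k : ℕ)) hy'.1]
  rw [e1]
  refine onestep pk hgb hl hlC ?_ ?_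
  · intro y hy
    refine (upper_of pk hgb hqb (sub_nonneg.2 hcd) (eq'.trans_le hq) ?_ y hy).trans hC
    intro y z hy hz
    have hy' := (cw_pos hw _ hx).1 hy
    have hz' := (cw_pos hw _ hx).1 hz
    have := gl hz'.2 hy'.2 (hz'.1.trans hy'.1.symm)
    rw [abs_sub_comm] at this
    exact (le_abs_self _).trans this
  · have hm := mass_pos hw (pre (k : ℕ)) hx
    have pfx : (prOf μ (prefixSet k x)).toReal = mass w (pre (k : ℕ)) x := by
      rw [prOf_toReal, ex_ind]
      unfold mass
      congr 2
      ext z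
      simp [prefixSet, pre_eq, hwdef]
    have hpp : 0 < prOf μ (prefixSet k x) := by
      rw [pos_iff_ne_zero]
      intro h0
      rw [h0] at pfx
      exact hm.ne pfx
    obtain ⟨η, hη⟩ := hp x hpp
    have hη' := ENNReal.toReal_mono (prOf_ne_top μ _) hη
    rw [ENNReal.toReal_mul, ENNReal.toReal_ofReal (by linarith), pfx, prOf_toReal] at hη'
    have hy0 : ∃ y, y ∈ prefixSet k x ∩ {x | x k = η} ∧ 0 < w y := by
      by_contra hcon
      push Not at hcon
      have : ex (Wt μ) ((prefixSet k x ∩ {x | x k = η}).indicator fun _ => 1) = 0 := by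
        rw [ex_ind]
        have : (prefixSet k x ∩ {x | x k = η}).indicator (Wt μ) = fun _ => 0 := by
          ext z
          by_cases hz : z ∈ prefixSet k x ∩ {x | x k = η}
          · rw [Set.indicator_of_mem hz]
            exact le_antisymm (hcon z hz) (hw.1 z)
          · rw [Set.indicator_of_notMem hz]
        rw [this]; simp
      rw [this] at hη'
      nlinarith [mul_pos (sub_pos.2 hp1) hm]
    obtain ⟨y0, ⟨hy0p, hy0k⟩, hwy0⟩ := hy0
    have hpy : pre (k : ℕ) y0 = pre (k : ℕ) x := pre_eq.2 hy0p
    set T : Set (∀ j, Λ j) := {z | pre ((k : ℕ) + 1) z = pre ((k : ℕ) + 1) y0} with hT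
    have hTe : prefixSet k x ∩ {x | x k = η} = T := by
      ext z
      simp only [hT, Set.mem_ofPred_eq, pre_succ, hpy, Set.mem_inter_iff, prefixSet, pre_eq]
      have : y0 k = η := hy0k
      rw [this]
    rw [hTe] at hη'
    have hTmass : ex w (T.indicator fun _ => 1) = mass w (pre ((k : ℕ) + 1)) y0 := ex_ind _ _
    have hTsub : ∀ z ∈ T, pre (k : ℕ) z = pre (k : ℕ) x := fun z hz => (href _ _ hz).trans hpy
    have hm0 := mass_pos hw (pre ((k : ℕ) + 1)) hwy0
    have hq0 : 0 ≤ q y0 := by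
      have p0 := cw_pw hw (pre ((k : ℕ) + 1)) hwy0
      rw [← p0.ex_const 0]
      exact p0.ex_mono (Bd.const _) (Bd.ind _) fun z _ => Set.indicator_nonneg (by simp) z
    have hqle : q y0 ≤ γ / (1 - p) := by
      have i1 := CE_mul_mass hw (pre ((k : ℕ) + 1)) (g := Γᶜ.indicator fun _ => 1) hwy0
      have i2 := CE_mul_mass hw (pre (k : ℕ)) (g := Γᶜ.indicator fun _ => 1) hx
      have i3 : ex w (fun y => T.indicator (fun _ => 1) y * Γᶜ.indicator (fun _ => 1) y) ≤
          ex w (fun y => Set.indicator {z | pre (k : ℕ) z = pre (k : ℕ) x} (fun _ => 1) y *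
            Γᶜ.indicator (fun _ => 1) y) := by
        refine hw.ex_mono ((Bd.ind _).mul (Bd.ind _)) ((Bd.ind _).mul (Bd.ind _)) fun y _ => ?_
        refine mul_le_mul_of_nonneg_right ?_ (Set.indicator_nonneg (by simp) y)
        exact Set.indicator_le_indicator_of_subset hTsub (fun _ => zero_le_one) y
      rw [← i1, ← i2] at i3
      change mass w (pre ((k : ℕ) + 1)) y0 * q y0 ≤ _ at i3
      rw [le_div_iff₀ (by linarith)]
      have hη2 : (1 - p) * mass w (pre (k : ℕ)) x ≤ mass w (pre ((k : ℕ) + 1)) y0 :=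
        hη'.trans_eq hTmass
      have j1 := mul_le_mul_of_nonneg_right hη2 hq0
      have j2 := mul_le_mul_of_nonneg_left hq hm.le
      have : mass w (pre (k : ℕ)) x * (q y0 * (1 - p)) ≤ mass w (pre (k : ℕ)) x * γ := by
        nlinarith
      exact le_of_mul_le_mul_left this hm
    refine var_of pk hgb (G := g y0) T (fun y hy => CE_congr _ hy) ?_ ?_
    · have i1 := CE_mul_mass hw (pre (k : ℕ)) (g := T.indicator fun _ => 1) hx
      have i2 : ex w (fun y => Set.indicator {z | pre (k : ℕ) z = pre (k : ℕ) x} (fun _ => 1) y *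
            T.indicator (fun _ => 1) y) = ex w (T.indicator fun _ => 1) := by
        congr 1; ext y
        by_cases hy : y ∈ T
        · have := hTsub y hy
          simp [hy, this]
        · simp [hy]
      rw [i2] at i1
      have : mass w (pre (k : ℕ)) x * (1 - p) ≤ mass w (pre (k : ℕ)) x *
          CE w (pre (k : ℕ)) (T.indicator fun _ => 1) x := by
        rw [i1]; linarith
      exact le_of_mul_le_mul_left this hm
    · intro y hy
      have hy' := (cw_pos hw _ hx).1 hy
      have := gl hwy0 hy'.2 (hpy.trans hy'.1.symm)
      rw [abs_sub_comm] at this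
      refine this.trans ?_
      have := mul_le_mul_of_nonneg_left hqle (sub_nonneg.2 hcd)
      calc c + (d - c) * q y0 ≤ c + (d - c) * (γ / (1 - p)) := by linarith
        _ = _ := by ring

end main
end GBD

namespace GBD
section fin

/-- stopped increment -/
noncomputable def inc {N : ℕ} {Λ : Fin N → Type*} (μ : PMF (∀ j, Λ j)) (f : (∀ j, Λ j) → ℝ)
    (Γ : Set (∀ j, Λ j)) (γ : Fin N → ℝ) (k : Fin N) (x : ∀ j, Λ j) : ℝ :=
  open Classical in
  if CE (Wt μ) (pre (k : ℕ)) (Γᶜ.indicator fun _ => 1) x ≤ γ k then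
    CE (Wt μ) (pre ((k : ℕ) + 1)) f x - CE (Wt μ) (pre (k : ℕ)) f x else 0

/-- indices below `n` -/
def below (N n : ℕ) : Finset (Fin N) := Finset.univ.filter fun j => (j : ℕ) < n

lemma below_succ {N n : ℕ} (h : n < N) :
    below N (n + 1) = insert (⟨n, h⟩ : Fin N) (below N n) := by
  ext j
  simp only [below, Finset.mem_filter, Finset.mem_univ, true_and, Finset.mem_insert, Fin.ext_iff]
  omega

lemma notMem_below {N n : ℕ} (h : n < N) : (⟨n, h⟩ : Fin N) ∉ below N n := by
  simp [below]

lemma below_all (N : ℕ) : below N N = Finset.univ := by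
  ext j; simp [below]

variable {N : ℕ} {Λ : Fin N → Type*}

lemma inc_bd (μ : PMF (∀ j, Λ j)) (f : (∀ j, Λ j) → ℝ) (hf : Bd f)
    (Γ : Set (∀ j, Λ j)) (γ : Fin N → ℝ) (k : Fin N) : Bd (inc μ f Γ γ k) := by
  classical
  unfold inc
  exact Bd.ite _ ((CE_bd (Wt_pw μ) _ hf).sub (CE_bd (Wt_pw μ) _ hf)) (Bd.const 0)

lemma pre_mono {m n : ℕ} (hmn : m ≤ n) {x y : ∀ j, Λ j} (h : pre n x = pre n y) :
    pre m x = pre m y :=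
  pre_eq.2 fun j hj => pre_eq.1 h j (by omega)

lemma inc_congr (μ : PMF (∀ j, Λ j)) (f : (∀ j, Λ j) → ℝ)
    (Γ : Set (∀ j, Λ j)) (γ : Fin N → ℝ) (k : Fin N) {x y : ∀ j, Λ j}
    (h : pre ((k : ℕ) + 1) x = pre ((k : ℕ) + 1) y) : inc μ f Γ γ k x = inc μ f Γ γ k y := by
  have h' := pre_mono (Nat.le_succ _) h
  unfold inc
  rw [CE_congr _ h, CE_congr _ h', CE_congr _ h']

lemma mgf (μ : PMF (∀ j, Λ j)) (f : (∀ j, Λ j) → ℝ) (hf : Bd f)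
    (Γ : Set (∀ j, Λ j)) (γ : Fin N → ℝ) (v : Fin N → ℝ) (hv : ∀ k, 0 ≤ v k) (l : ℝ)
    (H : ∀ (k : Fin N) (x : ∀ j, Λ j), 0 < Wt μ x →
      CE (Wt μ) (pre (k : ℕ)) (Γᶜ.indicator fun _ => 1) x ≤ γ k →
      CE (Wt μ) (pre (k : ℕ)) (fun y => Real.exp (l * (CE (Wt μ) (pre ((k : ℕ) + 1)) f y -
        CE (Wt μ) (pre (k : ℕ)) f y))) x ≤ Real.exp (v k)) (n : ℕ) (hn : n ≤ N) :
    ex (Wt μ) (fun x => Real.exp (l * ∑ k ∈ below N n, inc μ f Γ γ k x)) ≤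
      Real.exp (∑ k ∈ below N n, v k) := by
  have hw := Wt_pw μ
  induction n with
  | zero => simp [below, hw.ex_const]
  | succ n ih =>
    have hnN : n < N := hn
    have ih := ih hnN.le
    rw [below_succ hnN]
    simp only [Finset.sum_insert (notMem_below hnN)]
    set k : Fin N := ⟨n, hnN⟩ with hk
    set u : (∀ j, Λ j) → ℝ := fun x => Real.exp (l * ∑ k ∈ below N n, inc μ f Γ γ k x) with hu
    set V : (∀ j, Λ j) → ℝ := fun x => Real.exp (l * inc μ f Γ γ k x) with hV
    have bu : Bd u := ((Bd.const l).mul (Bd.sum _ _ (inc_bd μ f hf Γ γ))).exp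
    have bV : Bd V := ((Bd.const l).mul (inc_bd μ f hf Γ γ k)).exp
    have e1 : (fun x => Real.exp (l * (inc μ f Γ γ k x + ∑ k ∈ below N n, inc μ f Γ γ k x))) =
        fun x => u x * V x := by
      ext x
      rw [hu, hV]
      simp only
      rw [← Real.exp_add]; congr 1; ring
    rw [e1, ← tower hw (pre n) bu bV, add_comm, Real.exp_add]
    · calc ex (Wt μ) (fun x => u x * CE (Wt μ) (pre n) V x)
          ≤ ex (Wt μ) (fun x => Real.exp (v k) * u x) := by
            refine hw.ex_mono (bu.mul (CE_bd hw _ bV)) ((Bd.const _).mul bu) fun x hx => ?_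
            rw [mul_comm]
            refine mul_le_mul_of_nonneg_right ?_ (Real.exp_pos _).le
            have pk := cw_pw hw (pre n) hx
            by_cases hgood : CE (Wt μ) (pre n) (Γᶜ.indicator fun _ => 1) x ≤ γ k
            · refine le_trans (le_of_eq ?_) (H k x hx hgood)
              refine ex_congr fun y hy => ?_
              have hy' := (cw_pos hw _ hx).1 (lt_of_le_of_ne (pk.1 y) (Ne.symm hy))
              have hgy : CE (Wt μ) (pre (k : ℕ)) (Γᶜ.indicator fun _ => 1) y ≤ γ k := by
                have := CE_congr (w := Wt μ) (pre n) (g := Γᶜ.indicator fun _ => 1) hy'.1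
                exact this.trans_le hgood
              rw [hV]
              simp only [inc]
              rw [if_pos hgy]
            · have : CE (Wt μ) (pre n) V x = 1 := by
                rw [← pk.ex_const 1]
                refine ex_congr fun y hy => ?_
                have hy' := (cw_pos hw _ hx).1 (lt_of_le_of_ne (pk.1 y) (Ne.symm hy))
                have hgy : ¬ CE (Wt μ) (pre (k : ℕ)) (Γᶜ.indicator fun _ => 1) y ≤ γ k := by
                  have := CE_congr (w := Wt μ) (pre n) (g := Γᶜ.indicator fun _ => 1) hy'.1
                  intro h
                  exact hgood (this.symm.trans_le h)
                rw [hV]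
                simp only [inc]
                rw [if_neg hgy]; simp
              rw [this]
              exact Real.one_le_exp (hv k)
        _ = Real.exp (v k) * ex (Wt μ) u := ex_smul _
        _ ≤ _ := by
            rw [mul_comm]
            exact mul_le_mul_of_nonneg_right ih (Real.exp_pos _).le
    · intro x y hxy
      rw [hu]
      simp only
      congr 2
      refine Finset.sum_congr rfl fun j hj => ?_
      simp only [below, Finset.mem_filter, Finset.mem_univ, true_and] at hj
      exact inc_congr μ f Γ γ j (pre_mono hj hxy)

lemma telescope (μ : PMF (∀ j, Λ j)) (f : (∀ j, Λ j) → ℝ)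
    (Γ : Set (∀ j, Λ j)) (γ : Fin N → ℝ) (x : ∀ j, Λ j) (hx : 0 < Wt μ x)
    (hgood : ∀ k : Fin N, CE (Wt μ) (pre (k : ℕ)) (Γᶜ.indicator fun _ => 1) x ≤ γ k) :
    ∑ k, inc μ f Γ γ k x = f x - ex (Wt μ) f := by
  have hw := Wt_pw μ
  have h1 : ∑ k, inc μ f Γ γ k x = ∑ k : Fin N, (CE (Wt μ) (pre ((k : ℕ) + 1)) f x -
      CE (Wt μ) (pre (k : ℕ)) f x) := by
    refine Finset.sum_congr rfl fun k _ => ?_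
    rw [inc, if_pos (hgood k)]
  rw [h1, Fin.sum_univ_eq_sum_range
    (fun n => CE (Wt μ) (pre (n + 1)) f x - CE (Wt μ) (pre n) f x) N,
    Finset.sum_range_sub (fun n => CE (Wt μ) (pre n) f x)]
  have e0 : CE (Wt μ) (pre 0) f x = ex (Wt μ) f := by
    have hc : ∀ y : (∀ j, Λ j), pre 0 y = pre 0 x := fun y => pre_eq.2 (by simp)
    have : cw (Wt μ) (pre 0) x = Wt μ := by
      ext y
      unfold cw mass
      simp [hc, hw.2.tsum_eq]
    unfold CE; rw [this]
  have eN : CE (Wt μ) (pre N) f x = f x := by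
    have pk := cw_pw hw (pre N) hx
    conv_rhs => rw [← pk.ex_const (f x)]
    refine ex_congr fun y hy => ?_
    have hy' := (cw_pos hw _ hx).1 (lt_of_le_of_ne (pk.1 y) (Ne.symm hy))
    have : y = x := by
      ext j; exact pre_eq.1 hy'.1 j j.2
    rw [this]
  rw [e0, eN]

lemma CE_zero (μ : PMF (∀ j, Λ j)) (f : (∀ j, Λ j) → ℝ) (x : ∀ j, Λ j) :
    CE (Wt μ) (pre 0) f x = ex (Wt μ) f := by
  have hw := Wt_pw μ
  have hc : ∀ y : (∀ j, Λ j), pre 0 y = pre 0 x := fun y => pre_eq.2 (by simp)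
  have : cw (Wt μ) (pre 0) x = Wt μ := by
    ext y
    unfold cw mass
    simp [hc, hw.2.tsum_eq]
  unfold CE; rw [this]

end fin
end GBD

/-- **General bounded differences inequality for asymmetric variables**
(Theorem 1.12 of Warnke). The random vector `X = (X_1, …, X_N)`, with not necessarily
independent coordinates, is modeled by its law `μ`, a probability mass function on the
product space (a discrete probability space); the condition
`max_{η ∈ Λ_k} P(X_k = η | X_1, …, X_{k-1}) ≥ 1 - p_k` is expressed for every possible
history. -/
theorem general_bounded_differences_asymmetric {N : ℕ} {Λ : Fin N → Type*}
    (μ : PMF (∀ j, Λ j))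
    (p : Fin N → ℝ) (hp0 : ∀ k, 0 ≤ p k) (hp1 : ∀ k, p k < 1)
    (hp : ∀ (k : Fin N) (x₀ : ∀ j, Λ j), 0 < prOf μ (prefixSet k x₀) →
      ∃ η : Λ k, ENNReal.ofReal (1 - p k) * prOf μ (prefixSet k x₀) ≤
        prOf μ (prefixSet k x₀ ∩ {x | x k = η}))
    (f : (∀ j, Λ j) → ℝ) (hfb : ∃ M : ℝ, ∀ x, |f x| ≤ M)
    (Γ : Set (∀ j, Λ j))
    (c d : Fin N → ℝ) (hcd : ∀ k, c k ≤ d k)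
    -- the general Lipschitz condition (GL)
    (hGL : ∀ (k : Fin N) (x₀ : ∀ j, Λ j) (a b : Λ k),
      (cylSet μ k x₀ a).Nonempty → (cylSet μ k x₀ b).Nonempty →
      ∃ ρ : (∀ j, Λ j) → (∀ j, Λ j),
        Set.MapsTo ρ (cylSet μ k x₀ a) (cylSet μ k x₀ b) ∧
        Set.InjOn ρ (cylSet μ k x₀ a) ∧
        ∀ x ∈ cylSet μ k x₀ a,
          (x ∈ Γ → |f x - f (ρ x)| ≤ c k) ∧
          (x ∉ Γ → |f x - f (ρ x)| ≤ d k) ∧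
          μ x / prOf μ (cylSet μ k x₀ a) ≤ μ (ρ x) / prOf μ (cylSet μ k x₀ b))
    (γ : Fin N → ℝ) (hγ : ∀ k, γ k ∈ Set.Ioc (0 : ℝ) 1)
    -- `C = max_k (c_k + e_k)` where `e_k = γ_k (d_k - c_k)`
    (C : ℝ) (hC : IsGreatest (Set.range fun k => c k + γ k * (d k - c k)) C) :
    ∃ B : Set (∀ j, Λ j),
      prOf μ B ≤ ∑ k, ENNReal.ofReal ((γ k)⁻¹) * prOf μ Γᶜ ∧
      Bᶜ ⊆ Γ ∧
      ∀ t : ℝ, 0 ≤ t →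
        prOf μ {x | f x ≥ (∑' x, (μ x).toReal * f x) + t ∧ x ∉ B} ≤
          ENNReal.ofReal (Real.exp (-t ^ 2 /
            (2 * ∑ k, p k * (c k + γ k * (d k - c k) / (1 - p k)) ^ 2 +
              2 * C * t / 3))) := by
  have hw := GBD.Wt_pw μ
  have hf : GBD.Bd f := hfb
  set Q := GBD.ex (GBD.Wt μ) (Γᶜ.indicator fun _ => 1) with hQ
  have hQe : prOf μ Γᶜ = ENNReal.ofReal Q := GBD.prOf_eq μ _
  have hQ0 : 0 ≤ Q := by
    rw [hQ, ← GBD.prOf_toReal]; exact ENNReal.toReal_nonneg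
  have hγi : ∀ k, 0 ≤ (γ k)⁻¹ := fun k => inv_nonneg.2 (hγ k).1.le
  have hRHS : ∑ k, ENNReal.ofReal ((γ k)⁻¹) * prOf μ Γᶜ = ENNReal.ofReal (∑ k, (γ k)⁻¹ * Q) := by
    rw [ENNReal.ofReal_sum_of_nonneg (fun k _ => mul_nonneg (hγi k) hQ0), hQe]
    refine Finset.sum_congr rfl fun k _ => ?_
    rw [ENNReal.ofReal_mul (hγi k)]
  rw [hRHS]
  obtain ⟨⟨k₁, hk₁⟩, hCub⟩ := hC
  have hN : 0 < N := lt_of_le_of_lt (Nat.zero_le _) k₁.2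
  set k₀ : Fin N := ⟨0, hN⟩ with hk₀
  by_cases hbig : 1 ≤ ∑ k, (γ k)⁻¹ * Q
  · refine ⟨Set.univ, (GBD.prOf_le_one μ _).trans (ENNReal.one_le_ofReal.2 hbig), by simp, ?_⟩
    intro t _
    simp [prOf]
  have hterm : ∀ k, (γ k)⁻¹ * Q < 1 := fun k =>
    lt_of_le_of_lt (Finset.single_le_sum (f := fun k => (γ k)⁻¹ * Q)
      (fun j _ => mul_nonneg (hγi j) hQ0) (Finset.mem_univ k)) (not_le.1 hbig)
  have hQγ : ∀ k, Q ≤ γ k := by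
    intro k
    have := hterm k
    rw [inv_mul_lt_iff₀ (hγ k).1, mul_one] at this
    exact this.le
  have hQ1 : Q < 1 := by
    have := hterm k₀
    rw [inv_mul_lt_iff₀ (hγ k₀).1, mul_one] at this
    exact this.trans_le (hγ k₀).2
  have hne : ∃ x, x ∈ Γ ∧ 0 < GBD.Wt μ x := by
    by_contra hcon
    push Not at hcon
    have : Q = 1 := by
      rw [hQ]
      refine Eq.trans (GBD.ex_congr fun x hx => ?_) (hw.ex_const 1)
      have : x ∉ Γ := fun hxΓ => hx (le_antisymm (hcon x hxΓ) (hw.1 x))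
      simp [this]
    linarith
  have hc0 : ∀ k, 0 ≤ c k := by
    intro k
    obtain ⟨x, hxΓ, hx⟩ := hne
    have hm : x ∈ cylSet μ k x (x k) := (GBD.mem_cyl μ rfl).2 ⟨rfl, hx⟩
    obtain ⟨ρ, _, _, H⟩ := hGL k x (x k) (x k) ⟨x, hm⟩ ⟨x, hm⟩
    exact (abs_nonneg _).trans ((H x hm).1 hxΓ)
  have hC0 : 0 ≤ C := by
    rw [← hk₁]
    exact add_nonneg (hc0 _) (mul_nonneg (hγ _).1.le (sub_nonneg.2 (hcd _)))
  set q : Fin N → (∀ j, Λ j) → ℝ := fun k =>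
    GBD.CE (GBD.Wt μ) (GBD.pre (k : ℕ)) (Γᶜ.indicator fun _ => 1) with hq
  have hqb : ∀ k, GBD.Bd (q k) := fun k => GBD.CE_bd hw _ (GBD.Bd.ind _)
  set B : Set (∀ j, Λ j) := {x | x ∉ Γ ∨ ∃ k, k ≠ k₀ ∧ γ k < q k x} with hB
  have hq0 : ∀ k x, 0 ≤ q k x := by
    intro k x
    refine tsum_nonneg fun y => mul_nonneg ?_ (Set.indicator_nonneg (by simp) y)
    exact div_nonneg (Set.indicator_nonneg (fun i _ => hw.1 i) y) (GBD.mass_nonneg hw _ x)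
  have hgoodB : ∀ x, x ∉ B → ∀ k, q k x ≤ γ k := by
    intro x hx k
    by_cases hk : k = k₀
    · subst hk
      have : q k₀ x = Q := GBD.CE_zero μ _ x
      rw [this]; exact hQγ _
    · by_contra hlt
      exact hx (Or.inr ⟨k, hk, not_le.1 hlt⟩)
  refine ⟨B, ?_, ?_, ?_⟩
  · rw [GBD.prOf_eq]
    refine ENNReal.ofReal_le_ofReal ?_
    set R : Fin N → (∀ j, Λ j) → ℝ := fun k => if k = k₀ then (Γᶜ.indicator fun _ => 1) else q k
      with hR
    have hRb : ∀ k, GBD.Bd (R k) := by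
      intro k
      by_cases hk : k = k₀
      · simp only [hR, hk, if_true]; exact GBD.Bd.ind _
      · simp only [hR, hk, if_false]; exact hqb k
    have hRe : ∀ k, GBD.ex (GBD.Wt μ) (R k) = Q := by
      intro k
      by_cases hk : k = k₀
      · simp only [hR, hk, if_true]; rfl
      · simp only [hR, hk, if_false]; exact GBD.ex_CE hw _ (GBD.Bd.ind _)
    have hR0 : ∀ k x, 0 ≤ R k x := by
      intro k x
      by_cases hk : k = k₀
      · simp only [hR, hk, if_true]; exact Set.indicator_nonneg (by simp) x
      · simp only [hR, hk, if_false]; exact hq0 k x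
    have hb' : ∀ k, GBD.Bd (fun x => (γ k)⁻¹ * R k x) := fun k => (GBD.Bd.const _).mul (hRb k)
    have hsum : GBD.ex (GBD.Wt μ) (fun x => ∑ k, (γ k)⁻¹ * R k x) = ∑ k, (γ k)⁻¹ * Q := by
      rw [hw.ex_sum _ (fun k x => (γ k)⁻¹ * R k x) hb']
      refine Finset.sum_congr rfl fun k _ => ?_
      rw [GBD.ex_smul, hRe]
    rw [← hsum]
    refine hw.ex_mono (GBD.Bd.ind _) (GBD.Bd.sum _ (fun k x => (γ k)⁻¹ * R k x) hb') fun x _ => ?_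
    have hnn : ∀ k ∈ Finset.univ, 0 ≤ (γ k)⁻¹ * R k x := fun k _ => mul_nonneg (hγi k) (hR0 k x)
    by_cases hx : x ∈ B
    · rw [Set.indicator_of_mem hx]
      rcases hx with hx | ⟨k, hk, hx⟩
      · refine le_trans ?_ (Finset.single_le_sum hnn (Finset.mem_univ k₀))
        have : R k₀ x = 1 := by simp [hR, hx]
        rw [this, mul_one]
        exact (one_le_inv₀ (hγ k₀).1).2 (hγ k₀).2
      · refine le_trans ?_ (Finset.single_le_sum hnn (Finset.mem_univ k))
        have : R k x = q k x := by simp [hR, hk]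
        rw [this, le_inv_mul_iff₀ (hγ k).1, mul_one]
        exact hx.le
    · rw [Set.indicator_of_notMem hx]
      exact Finset.sum_nonneg hnn
  · intro x hx
    by_contra hxΓ
    exact hx (Or.inl hxΓ)
  · intro t ht
    set v : Fin N → ℝ := fun k => p k * (c k + γ k * (d k - c k) / (1 - p k)) ^ 2 with hv
    have hv0 : ∀ k, 0 ≤ v k := fun k => mul_nonneg (hp0 k) (sq_nonneg _)
    set V := ∑ k, v k with hV
    have hV0 : 0 ≤ V := Finset.sum_nonneg fun k _ => hv0 k
    rw [GBD.prOf_eq]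
    refine ENNReal.ofReal_le_ofReal ?_
    change GBD.ex (GBD.Wt μ) ({x | f x ≥ GBD.ex (GBD.Wt μ) f + t ∧ x ∉ B}.indicator fun _ => 1) ≤ _
    set A : Set (∀ j, Λ j) := {x | f x ≥ GBD.ex (GBD.Wt μ) f + t ∧ x ∉ B} with hA
    have chern : ∀ l : ℝ, 0 ≤ l → l * C < 3 →
        GBD.ex (GBD.Wt μ) (A.indicator fun _ => 1) ≤
          Real.exp (-(l * t) + l ^ 2 * V / (2 * (1 - l * C / 3))) := by
      intro l hl hlC
      have hK : 0 < 2 * (1 - l * C / 3) := by linarith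
      have m1 := GBD.mgf μ f hf Γ γ (fun k => l ^ 2 * v k / (2 * (1 - l * C / 3)))
        (fun k => div_nonneg (mul_nonneg (sq_nonneg _) (hv0 k)) hK.le) l
        (fun k x hx hqx => GBD.mstep μ f hf Γ (c k) (d k) (p k) (γ k) (hp1 k) (hcd k) k (hp k)
          (hGL k) hl hlC (hCub ⟨k, rfl⟩) hx hqx) N le_rfl
      rw [GBD.below_all, ← Finset.sum_div, ← Finset.mul_sum] at m1
      have bS : GBD.Bd (fun x => Real.exp (l * ∑ k, GBD.inc μ f Γ γ k x)) :=
        ((GBD.Bd.const l).mul (GBD.Bd.sum _ _ (GBD.inc_bd μ f hf Γ γ))).exp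
      calc GBD.ex (GBD.Wt μ) (A.indicator fun _ => 1)
          ≤ GBD.ex (GBD.Wt μ) (fun x => Real.exp (-(l * t)) *
              Real.exp (l * ∑ k, GBD.inc μ f Γ γ k x)) := by
            refine hw.ex_mono (GBD.Bd.ind _) ((GBD.Bd.const _).mul bS) fun x hx => ?_
            by_cases hxA : x ∈ A
            · rw [Set.indicator_of_mem hxA, GBD.telescope μ f Γ γ x hx (hgoodB x hxA.2),
                ← Real.exp_add]
              refine Real.one_le_exp ?_
              have := hxA.1
              nlinarith
            · rw [Set.indicator_of_notMem hxA]; positivity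
        _ = Real.exp (-(l * t)) * GBD.ex (GBD.Wt μ)
              (fun x => Real.exp (l * ∑ k, GBD.inc μ f Γ γ k x)) := GBD.ex_smul _
        _ ≤ Real.exp (-(l * t)) * Real.exp (l ^ 2 * V / (2 * (1 - l * C / 3))) :=
            mul_le_mul_of_nonneg_left m1 (Real.exp_pos _).le
        _ = _ := by rw [← Real.exp_add]
    have htriv : GBD.ex (GBD.Wt μ) (A.indicator fun _ => 1) ≤ 1 := by
      have := chern 0 le_rfl (by simp)
      simpa using this
    rcases hV0.eq_or_lt with hVz | hVp
    · rw [← hVz]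
      by_cases hCt : C * t = 0
      · have : 2 * (0 : ℝ) + 2 * C * t / 3 = 0 := by
          rw [mul_assoc, hCt]; simp
        rw [this]; simpa using htriv
      · have hCne : C ≠ 0 := fun h => hCt (by simp [h])
        have htne : t ≠ 0 := fun h => hCt (by simp [h])
        have hCp : 0 < C := lt_of_le_of_ne hC0 (Ne.symm hCne)
        refine (chern (3 / (2 * C)) (by positivity) ?_).trans (le_of_eq ?_)
        · have : 3 / (2 * C) * C = 3 / 2 := by field_simp
          rw [this]; norm_num
        · rw [← hVz]
          congr 1
          simp only [mul_zero, zero_div, add_zero, zero_add]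
          field_simp
    · have hD : 0 < V + C * t / 3 := by positivity
      have hl : t / (V + C * t / 3) * C < 3 := by
        rw [div_mul_eq_mul_div, div_lt_iff₀ hD]; nlinarith
      refine (chern (t / (V + C * t / 3)) (by positivity) hl).trans (le_of_eq ?_)
      congr 1
      have h1 : 1 - t / (V + C * t / 3) * C / 3 = V / (V + C * t / 3) := by
        field_simp; ring
      rw [h1]
      have h2 : 2 * V + 2 * C * t / 3 = 2 * (V + C * t / 3) := by ring
      rw [h2]
      generalize V + C * t / 3 = D at *
      field_simp
      ring
end

section
/- Bounded variances (Freedman-type) martingale inequality. Let (F_k)_{0≤k≤N} be an increasing sequence of σ-algebras and (M_k)_{0≤k≤N} an (F_k)-adapted bounded martingale. Let U_k be an F_{k−1}-measurable random variable satisfying M_k − M_{k−1} ≤ U_k almost surely, and set C_k = max_{i∈[k]} U_i and V_k = Σ_{i∈[k]} Var(M_i − M_{i−1} | F_{i−1}). Let φ(x) = (1+x)log(1+x) − x. Then for every t ≥ 0 and V, C > 0, P(M_k ≥ M_0 + t, V_k ≤ V and C_k ≤ C for some k ∈ [N]) ≤ exp(−(V/C²)·φ(Ct/V)) ≤ exp(−t²/(2V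 + 2Ct/3)). -/
open MeasureTheory

lemma bvm_exp_aux {y c : ℝ} (hc : 0 ≤ c) (hy : y ≤ c) :
    (Real.exp y - 1 - y) * c ^ 2 ≤ (Real.exp c - 1 - c) * y ^ 2 := by
  rcases le_total y 0 with h | h
  · have h1 : Real.exp y - 1 - y ≤ y ^ 2 / 2 := by
      have h2 := Real.quadratic_le_exp_of_nonneg (x := -y) (by linarith)
      have h3 : Real.exp y * Real.exp (-y) = 1 := by rw [← Real.exp_add]; simp
      have h4 := Real.exp_pos y
      have h5 : 0 < 1 + y + y ^ 2 / 2 := by nlinarith [sq_nonneg (y + 1)]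
      have h6 : Real.exp y * (1 - y + y ^ 2 / 2) ≤ 1 := by
        rw [← h3]; apply mul_le_mul_of_nonneg_left _ h4.le; linarith
      have h7 : 0 < 1 - y + y ^ 2 / 2 := by nlinarith [sq_nonneg y]
      by_contra hcon
      push Not at hcon
      have h8 : (1 + y + y ^ 2 / 2) * (1 - y + y ^ 2 / 2) < Real.exp y * (1 - y + y ^ 2 / 2) :=
        mul_lt_mul_of_pos_right (by linarith) h7
      nlinarith [sq_nonneg (y ^ 2)]
    have h2 : c ^ 2 / 2 ≤ Real.exp c - 1 - c := by
      have := Real.quadratic_le_exp_of_nonneg hc; linarith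
    calc _ ≤ y ^ 2 / 2 * c ^ 2 := mul_le_mul_of_nonneg_right h1 (sq_nonneg _)
      _ = c ^ 2 / 2 * y ^ 2 := by ring
      _ ≤ _ := mul_le_mul_of_nonneg_right h2 (sq_nonneg _)
  · have key : ∀ x : ℝ, HasSum (fun n : ℕ => x ^ (n + 2) / (Nat.factorial (n + 2) : ℝ))
        (Real.exp x - 1 - x) := by
      intro x
      have h1 : HasSum (fun n : ℕ => x ^ n / (Nat.factorial n : ℝ)) (Real.exp x) := by
        rw [Real.exp_eq_exp_ℝ]; exact NormedSpace.expSeries_div_hasSum_exp x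
      have h2 := (hasSum_nat_add_iff' 2).mpr h1
      have h3 : Real.exp x - ∑ i ∈ Finset.range 2, x ^ i / (Nat.factorial i : ℝ)
          = Real.exp x - 1 - x := by
        simp [Finset.sum_range_succ]; ring
      rwa [h3] at h2
    refine hasSum_le (fun n => ?_) ((key y).mul_right (c ^ 2)) ((key c).mul_right (y ^ 2))
    have : y ^ n ≤ c ^ n := pow_le_pow_left₀ h hy n
    rw [div_mul_eq_mul_div, div_mul_eq_mul_div]
    apply div_le_div_of_nonneg_right _ (by positivity)
    calc y ^ (n + 2) * c ^ 2 = y ^ n * (y ^ 2 * c ^ 2) := by ring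
      _ ≤ c ^ n * (y ^ 2 * c ^ 2) := mul_le_mul_of_nonneg_right this (by positivity)
      _ = _ := by ring

lemma bvm_exp_le {l x C : ℝ} (hl : 0 ≤ l) (hC : 0 < C) (hx : x ≤ C) :
    Real.exp (l * x) ≤ 1 + l * x + (Real.exp (l * C) - 1 - l * C) / C ^ 2 * x ^ 2 := by
  rcases hl.eq_or_lt with h | h
  · subst h; simp
  have h1 := bvm_exp_aux (y := l * x) (c := l * C) (by positivity)
    (mul_le_mul_of_nonneg_left hx hl)
  have h2 : (Real.exp (l * x) - 1 - l * x) * C ^ 2 ≤ (Real.exp (l * C) - 1 - l * C) * x ^ 2 := by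
    have : 0 < l ^ 2 := by positivity
    nlinarith
  have h3 : Real.exp (l * x) - 1 - l * x ≤ (Real.exp (l * C) - 1 - l * C) * x ^ 2 / C ^ 2 := by
    rw [le_div_iff₀ (by positivity)]; exact h2
  rw [div_mul_eq_mul_div]; linarith

lemma bvm_log_aux {x : ℝ} (hx : 0 ≤ x) :
    3 / 2 * (1 - 9 / (x + 3) ^ 2) ≤ Real.log (1 + x) := by
  have hd : ∀ y : ℝ, 0 ≤ y → HasDerivAt
      (fun x : ℝ => Real.log (1 + x) - 3 / 2 * (1 - 9 / (x + 3) ^ 2))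
      (1 / (1 + y) - 27 / (y + 3) ^ 3) y := by
    intro y hy
    have h1 : HasDerivAt (fun x : ℝ => Real.log (1 + x)) (1 / (1 + y)) y :=
      ((hasDerivAt_id y).const_add 1).log (by simp; positivity)
    have h2 : HasDerivAt (fun x : ℝ => (x + 3) ^ 2) (2 * (y + 3)) y := by
      exact (((hasDerivAt_id y).add_const 3).pow 2).congr_deriv (by simp)
    have h3 := (((hasDerivAt_const y (9 : ℝ)).div h2 (by positivity)).const_sub 1).const_mul
      (3 / 2 : ℝ)
    refine (h1.sub h3).congr_deriv ?_
    field_simp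
    ring
  have hm : MonotoneOn (fun x : ℝ => Real.log (1 + x) - 3 / 2 * (1 - 9 / (x + 3) ^ 2))
      (Set.Ici 0) := by
    apply monotoneOn_of_deriv_nonneg (convex_Ici 0)
    · exact fun y hy => (hd y hy).continuousAt.continuousWithinAt
    · exact fun y hy => (hd y (interior_subset hy)).differentiableAt.differentiableWithinAt
    · intro y hy
      have hy0 : 0 ≤ y := interior_subset hy
      rw [(hd y hy0).deriv, sub_nonneg, div_le_div_iff₀ (by positivity) (by positivity)]
      nlinarith [pow_nonneg hy0 3, pow_nonneg hy0 2]
  have := hm (Set.mem_Ici.2 le_rfl) (Set.mem_Ici.2 hx) hx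
  norm_num at this
  linarith

lemma bvm_phi {x : ℝ} (hx : 0 ≤ x) :
    3 * x ^ 2 / (6 + 2 * x) ≤ (1 + x) * Real.log (1 + x) - x := by
  have hd : ∀ y : ℝ, 0 ≤ y → HasDerivAt
      (fun x : ℝ => (1 + x) * Real.log (1 + x) - x - 3 * x ^ 2 / (6 + 2 * x))
      (Real.log (1 + y) - 3 / 2 * (1 - 9 / (y + 3) ^ 2)) y := by
    intro y hy
    have h0 : HasDerivAt (fun x : ℝ => 1 + x) 1 y := (hasDerivAt_id y).const_add 1
    have h1 : HasDerivAt (fun x : ℝ => Real.log (1 + x)) (1 / (1 + y)) y :=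
      h0.log (by positivity)
    have h2 : HasDerivAt (fun x : ℝ => 3 * x ^ 2) (3 * (2 * y)) y := by
      simpa using ((hasDerivAt_id y).pow 2).const_mul 3
    have h3 : HasDerivAt (fun x : ℝ => 6 + 2 * x) 2 y := by
      simpa using ((hasDerivAt_id y).const_mul 2).const_add 6
    have h4 := ((h0.mul h1).sub (hasDerivAt_id y)).sub (h2.div h3 (by positivity))
    refine h4.congr_deriv ?_
    have : (6 + 2 * y) = 2 * (y + 3) := by ring
    rw [this]
    field_simp
    ring
  have hm : MonotoneOn (fun x : ℝ => (1 + x) * Real.log (1 + x) - x - 3 * x ^ 2 / (6 + 2 * x))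
      (Set.Ici 0) := by
    apply monotoneOn_of_deriv_nonneg (convex_Ici 0)
    · exact fun y hy => (hd y hy).continuousAt.continuousWithinAt
    · exact fun y hy => (hd y (interior_subset hy)).differentiableAt.differentiableWithinAt
    · intro y hy
      have hy0 : 0 ≤ y := interior_subset hy
      rw [(hd y hy0).deriv, sub_nonneg]
      exact bvm_log_aux hy0
  have := hm (Set.mem_Ici.2 le_rfl) (Set.mem_Ici.2 hx) hx
  norm_num at this
  linarith

lemma bvm_step {Ω : Type*} {m m0 : MeasurableSpace Ω} (hm : m ≤ m0)
    {P : Measure Ω} [IsProbabilityMeasure P] {X W H K : Ω → ℝ} {l a b D : ℝ}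
    (hX : StronglyMeasurable X) (hXb : ∀ ω, |X ω| ≤ b)
    (hX0 : P[X | m] =ᵐ[P] 0) (hW : P[fun ω => X ω ^ 2 | m] =ᵐ[P] W)
    (hH : StronglyMeasurable[m] H) (hH0 : ∀ ω, 0 ≤ H ω) (hHb : ∀ᵐ ω ∂P, H ω ≤ D)
    (hHX : ∀ᵐ ω ∂P, H ω ≠ 0 → Real.exp (l * X ω) ≤ 1 + l * X ω + a * X ω ^ 2)
    (hK : Integrable K P) (hHK : ∀ᵐ ω ∂P, H ω * Real.exp (a * W ω) ≤ K ω) :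
    ∫ ω, H ω * Real.exp (l * X ω) ∂P ≤ ∫ ω, K ω ∂P := by
  have hX1 : Integrable X P := Integrable.of_bound hX.aestronglyMeasurable b
    (.of_forall fun ω => by simpa using hXb ω)
  have hX2 : Integrable (fun ω => X ω ^ 2) P := by
    refine Integrable.of_bound (hX.pow 2).aestronglyMeasurable (b ^ 2) (.of_forall fun ω => ?_)
    rw [Real.norm_eq_abs, abs_pow]
    exact pow_le_pow_left₀ (abs_nonneg _) (hXb ω) 2
  have hHn : ∀ᵐ ω ∂P, ‖H ω‖ ≤ D := by
    filter_upwards [hHb] with ω h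
    rwa [Real.norm_eq_abs, abs_of_nonneg (hH0 ω)]
  have hHm := (hH.mono hm).aestronglyMeasurable (μ := P)
  have hi1 : Integrable H P := Integrable.of_bound hHm D hHn
  have hiX : Integrable (H * X) P := hX1.bdd_mul hHm hHn
  have hiX2 : Integrable (H * fun ω => X ω ^ 2) P := hX2.bdd_mul hHm hHn
  have e1 : ∫ ω, (H * X) ω ∂P = 0 := by
    rw [← integral_condExp hm]
    have : P[H * X | m] =ᵐ[P] 0 := by
      filter_upwards [condExp_mul_of_stronglyMeasurable_left hH hiX hX1, hX0] with ω h1 h2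
      rw [h1]; simp [h2]
    rw [integral_congr_ae this]; simp
  have hc2 : P[H * (fun ω => X ω ^ 2) | m] =ᵐ[P] fun ω => H ω * W ω := by
    filter_upwards [condExp_mul_of_stronglyMeasurable_left hH hiX2 hX2, hW] with ω h1 h2
    rw [h1]; simp [h2]
  have e2 : ∫ ω, (H * fun ω => X ω ^ 2) ω ∂P = ∫ ω, H ω * W ω ∂P := by
    rw [← integral_condExp hm]
    exact integral_congr_ae hc2
  have hiW : Integrable (fun ω => H ω * W ω) P := integrable_condExp.congr hc2
  calc ∫ ω, H ω * Real.exp (l * X ω) ∂P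
      ≤ ∫ ω, (H ω + l * (H * X) ω + a * (H * fun ω => X ω ^ 2) ω) ∂P := by
        apply integral_mono_of_nonneg
        · exact .of_forall fun ω => mul_nonneg (hH0 ω) (Real.exp_pos _).le
        · exact (hi1.add (hiX.const_mul l)).add (hiX2.const_mul a)
        · filter_upwards [hHX] with ω h
          by_cases h0 : H ω = 0
          · simp [h0]
          · have := mul_le_mul_of_nonneg_left (h h0) (hH0 ω)
            simp only [Pi.mul_apply]
            linarith
    _ = ∫ ω, (H ω + a * (H ω * W ω)) ∂P := by
        have e3 : Integrable (fun ω => H ω + l * (H * X) ω) P := hi1.add (hiX.const_mul l)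
        rw [integral_add e3 (hiX2.const_mul a), integral_add hi1 (hiX.const_mul l), integral_add hi1 (hiW.const_mul a),
          integral_const_mul, integral_const_mul, integral_const_mul, e1, e2]
        ring
    _ ≤ ∫ ω, K ω ∂P := by
        apply integral_mono_ae (hi1.add (hiW.const_mul a)) hK
        filter_upwards [hHK] with ω h
        refine le_trans ?_ h
        have := mul_le_mul_of_nonneg_left (Real.add_one_le_exp (a * W ω)) (hH0 ω)
        simp only [Pi.add_apply]
        linarith

lemma bvm_main {Ω : Type*} {m0 : MeasurableSpace Ω}
    {P : Measure Ω} [IsProbabilityMeasure P]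
    (N : ℕ) (ℱ : Filtration ℕ m0)
    (M : ℕ → Ω → ℝ) (hM : Martingale M ℱ P) {R : ℝ}
    (hR : ∀ k ω, |M k ω| ≤ R)
    (U W : ℕ → Ω → ℝ)
    (hU : ∀ k, k < N → StronglyMeasurable[ℱ k] (U (k + 1)))
    (hW : ∀ k, StronglyMeasurable[ℱ k] (W (k + 1)))
    (hW' : ∀ k, P[fun ω => (M (k + 1) ω - M k ω) ^ 2 | ℱ k] =ᵐ[P] W (k + 1))
    (hMU : ∀ k, k < N → ∀ᵐ ω ∂P, M (k + 1) ω - M k ω ≤ U (k + 1) ω)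
    (t V C l a : ℝ) (hC : 0 < C) (hl : 0 ≤ l)
    (ha : a = (Real.exp (l * C) - 1 - l * C) / C ^ 2) :
    P.real {ω | ∃ k, 1 ≤ k ∧ k ≤ N ∧ M k ω ≥ M 0 ω + t ∧
        (∑ i ∈ Finset.Icc 1 k, W i ω) ≤ V ∧
        (∀ i, 1 ≤ i → i ≤ k → U i ω ≤ C)} * Real.exp (l * t - a * V) ≤ 1 := by
  classical
  have ha0 : 0 ≤ a := by
    rw [ha]
    have := Real.add_one_le_exp (l * C)
    apply div_nonneg _ (by positivity)
    linarith
  set S : ℕ → Ω → ℝ := fun k ω => ∑ i ∈ Finset.Icc 1 k, W i ω with hS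
  have hSs : ∀ k ω, S (k + 1) ω = S k ω + W (k + 1) ω := fun k ω =>
    Finset.sum_Icc_succ_top (by omega) _
  let G : ℕ → Set Ω := fun k => {ω | ∀ i, 1 ≤ i → i ≤ k → U i ω ≤ C}
  let A : ℕ → Set Ω := fun k => {ω | M 0 ω + t ≤ M k ω ∧ S k ω ≤ V ∧ ω ∈ G k}
  let B : ℕ → Set Ω := fun k => {ω | ∀ j, 1 ≤ j → j ≤ k → ω ∉ A j}
  let Z : ℕ → Ω → ℝ := fun k =>
    (G k).indicator fun ω => Real.exp (l * (M k ω - M 0 ω) - a * S k ω)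
  have hMm : ∀ j k, j ≤ k → StronglyMeasurable[ℱ k] (M j) := fun j k h =>
    (hM.stronglyAdapted j).mono (ℱ.mono h)
  have hSm : ∀ j k, j ≤ k + 1 → StronglyMeasurable[ℱ k] (S j) := by
    intro j k h
    apply Finset.stronglyMeasurable_fun_sum
    intro i hi
    rw [Finset.mem_Icc] at hi
    obtain ⟨i, rfl⟩ : ∃ i', i = i' + 1 := ⟨i - 1, by omega⟩
    exact (hW i).mono (ℱ.mono (by omega))
  have hGm : ∀ j k, j ≤ k + 1 → j ≤ N → MeasurableSet[ℱ k] (G j) := by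
    intro j k h hN
    have : G j = ⋂ i ∈ Finset.Icc 1 j, {ω | U i ω ≤ C} := by
      ext ω; simp [G]
    rw [this]
    apply Finset.measurableSet_biInter
    intro i hi
    rw [Finset.mem_Icc] at hi
    obtain ⟨i, rfl⟩ : ∃ i', i = i' + 1 := ⟨i - 1, by omega⟩
    exact (((hU i (by omega)).mono (ℱ.mono (by omega))).measurable) measurableSet_Iic
  have hAm : ∀ j k, j ≤ k → j ≤ N → MeasurableSet[ℱ k] (A j) := by
    intro j k h hN
    have h1 : MeasurableSet[ℱ k] {ω | M 0 ω + t ≤ M j ω} :=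
      measurableSet_le ((hMm 0 k (by omega)).measurable.add_const t) (hMm j k h).measurable
    have h2 : MeasurableSet[ℱ k] {ω | S j ω ≤ V} :=
      (hSm j k (by omega)).measurable measurableSet_Iic
    exact h1.inter (h2.inter (hGm j k (by omega) hN))
  have hBm : ∀ j k, j ≤ k → j ≤ N → MeasurableSet[ℱ k] (B j) := by
    intro j k h hN
    have : B j = ⋂ i ∈ Finset.Icc 1 j, (A i)ᶜ := by
      ext ω; simp [B]
    rw [this]
    apply Finset.measurableSet_biInter
    intro i hi
    rw [Finset.mem_Icc] at hi
    exact (hAm i k (by omega) (by omega)).compl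
  have hWpos : ∀ᵐ ω ∂P, ∀ k, 0 ≤ W (k + 1) ω := by
    rw [ae_all_iff]
    intro k
    filter_upwards [hW' k, condExp_nonneg (m := ℱ k) (μ := P)
      (f := fun ω => (M (k + 1) ω - M k ω) ^ 2) (.of_forall fun ω => sq_nonneg _)] with ω h1 h2
    rw [← h1]; exact h2
  have hSpos : ∀ᵐ ω ∂P, ∀ k, 0 ≤ S k ω := by
    filter_upwards [hWpos] with ω h k
    apply Finset.sum_nonneg
    intro i hi
    rw [Finset.mem_Icc] at hi
    obtain ⟨i, rfl⟩ : ∃ i', i = i' + 1 := ⟨i - 1, by omega⟩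
    exact h i
  have hMd : ∀ j k ω, M j ω - M k ω ≤ 2 * R := fun j k ω => by
    have h1 := abs_le.1 (hR j ω); have h2 := abs_le.1 (hR k ω); linarith
  have hbd : ∀ᵐ ω ∂P, ∀ j k, Real.exp (l * (M j ω - M 0 ω) - a * S k ω)
      ≤ Real.exp (l * (2 * R)) := by
    filter_upwards [hSpos] with ω h j k
    apply Real.exp_le_exp.2
    have h1 := mul_le_mul_of_nonneg_left (hMd j 0 ω) hl
    have h2 := mul_nonneg ha0 (h k)
    linarith
  have hEm : ∀ j j' k, j ≤ k → j' ≤ k + 1 → StronglyMeasurable[ℱ k]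
      (fun ω => Real.exp (l * (M j ω - M 0 ω) - a * S j' ω)) := by
    intro j j' k h h'
    exact Real.continuous_exp.comp_stronglyMeasurable
      ((((hMm j k h).sub (hMm 0 k (by omega))).const_mul l).sub ((hSm j' k h').const_mul a))
  have hE0 : ∀ j j' ω, 0 ≤ Real.exp (l * (M j ω - M 0 ω) - a * S j' ω) :=
    fun _ _ _ => (Real.exp_pos _).le
  have hZ0 : ∀ k ω, 0 ≤ Z k ω := fun k ω => Set.indicator_nonneg (fun ω _ => hE0 _ _ ω) ω
  have hZi : ∀ k, k ≤ N → Integrable (Z k) P := by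
    intro k hk
    refine Integrable.of_bound (C := Real.exp (l * (2 * R)))
      (((hEm k k k le_rfl (by omega)).indicator
        (hGm k k (by omega) hk)).mono (ℱ.le k)).aestronglyMeasurable ?_
    filter_upwards [hbd] with ω h
    rw [Real.norm_eq_abs, abs_of_nonneg (hZ0 k ω)]
    exact Set.indicator_apply_le' (fun _ => h k k) (fun _ => (Real.exp_pos _).le)
  have hstep : ∀ k, k < N → ∫ ω, (B k).indicator (Z (k + 1)) ω ∂P
      ≤ ∫ ω, (B k).indicator (Z k) ω ∂P := by
    intro k hk
    have hint : Integrable (fun ω => M (k + 1) ω - M k ω) P :=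
      (hM.integrable (k + 1)).sub (hM.integrable k)
    have hX0 : P[fun ω => M (k + 1) ω - M k ω | ℱ k] =ᵐ[P] 0 := by
      have h1 := condExp_sub (hM.integrable (k + 1)) (hM.integrable k) (ℱ k)
      have h2 := hM.condExp_ae_eq (Nat.le_succ k)
      have h3 := hM.condExp_ae_eq (le_refl k)
      filter_upwards [h1, h2, h3] with ω h1 h2 h3
      have h4 : (P[fun ω => M (k + 1) ω - M k ω | ℱ k]) ω
        = (P[M (k + 1) | ℱ k]) ω - (P[M k | ℱ k]) ω := h1
      rw [h4, h3]
      have h5 : (P[M (k + 1) | ℱ k]) ω = M k ω := h2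
      rw [h5]; simp
    have := bvm_step (P := P) (ℱ.le k) (X := fun ω => M (k + 1) ω - M k ω) (W := W (k + 1))
      (H := (B k ∩ G (k + 1)).indicator
        fun ω => Real.exp (l * (M k ω - M 0 ω) - a * S (k + 1) ω))
      (K := (B k).indicator (Z k)) (l := l) (a := a) (b := 2 * R) (D := Real.exp (l * (2 * R)))
      (((hMm (k + 1) (k + 1) le_rfl).sub (hMm k (k + 1) (by omega))).mono (ℱ.le (k + 1)))
      (fun ω => abs_le.2 ⟨by linarith [hMd k (k + 1) ω], hMd _ _ _⟩)
      hX0 (hW' k)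
      ((hEm k (k + 1) k le_rfl le_rfl).indicator
        ((hBm k k le_rfl hk.le).inter (hGm (k + 1) k le_rfl hk)))
      (fun ω => Set.indicator_nonneg (fun ω _ => hE0 _ _ ω) ω)
      (by
        filter_upwards [hbd] with ω h
        exact Set.indicator_apply_le' (fun _ => h k (k + 1)) (fun _ => (Real.exp_pos _).le))
      (by
        filter_upwards [hMU k hk] with ω h h0
        have hmem := Set.mem_of_indicator_ne_zero h0
        rw [ha]
        exact bvm_exp_le hl hC (h.trans (hmem.2 (k + 1) (by omega) le_rfl)))
      ((hZi k hk.le).indicator (ℱ.le k _ (hBm k k le_rfl hk.le)))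
      (by
        refine .of_forall fun ω => ?_
        by_cases hω : ω ∈ B k ∩ G (k + 1)
        · have hg : ω ∈ G k := fun i h1 h2 => hω.2 i h1 (by omega)
          rw [Set.indicator_of_mem hω, Set.indicator_of_mem hω.1]
          simp only [Z]
          rw [Set.indicator_of_mem hg, ← Real.exp_add, hSs]
          apply le_of_eq; congr 1; ring
        · rw [Set.indicator_of_notMem hω, zero_mul]
          exact Set.indicator_nonneg (fun ω _ => hZ0 k ω) ω)
    refine le_trans (le_of_eq (integral_congr_ae (.of_forall fun ω => ?_))) this
    simp only [Z]
    rw [Set.indicator_indicator]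
    by_cases hω : ω ∈ B k ∩ G (k + 1)
    · rw [Set.indicator_of_mem hω, Set.indicator_of_mem hω, ← Real.exp_add]
      congr 1; ring
    · rw [Set.indicator_of_notMem hω, Set.indicator_of_notMem hω, zero_mul]
  have hclaim : ∀ k, k ≤ N → ∫ ω, (B k).indicator (Z k) ω ∂P
      + P.real (B k)ᶜ * Real.exp (l * t - a * V) ≤ 1 := by
    intro k
    induction k with
    | zero =>
      intro _
      have hB : B 0 = Set.univ := by
        ext ω; simp only [B, Set.mem_ofPred_eq, Set.mem_univ, iff_true]; intro j h1 h2; omega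
      have hG : G 0 = Set.univ := by
        ext ω; simp only [G, Set.mem_ofPred_eq, Set.mem_univ, iff_true]; intro j h1 h2; omega
      simp [hB, Z, hG, hS]
    | succ k ih =>
      intro hk
      have ih := ih (by omega)
      have hB1 := ℱ.le _ _ (hBm k k le_rfl (by omega))
      have hB2 := ℱ.le _ _ (hBm (k + 1) (k + 1) le_rfl hk)
      have hsub : B (k + 1) ⊆ B k := fun ω h j h1 h2 => h j h1 (by omega)
      have hD : MeasurableSet (B k \ B (k + 1)) := hB1.diff hB2
      have hcomp : P.real (B (k + 1))ᶜ = P.real (B k)ᶜ + P.real (B k \ B (k + 1)) := by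
        rw [← measureReal_union _ hD]
        · congr 1
          ext ω
          have := @hsub ω
          simp only [Set.mem_compl_iff, Set.mem_union, Set.mem_sdiff]
          tauto
        · rw [Set.disjoint_left]; intro ω h1 h2; exact h1 h2.1
      have hle : ∫ ω, ((B (k + 1)).indicator (Z (k + 1)) ω
          + (B k \ B (k + 1)).indicator (fun _ => Real.exp (l * t - a * V)) ω) ∂P
          ≤ ∫ ω, (B k).indicator (Z (k + 1)) ω ∂P := by
        apply integral_mono
        · exact ((hZi _ hk).indicator hB2).add ((integrable_const _).indicator hD)
        · exact (hZi _ hk).indicator hB1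
        · intro ω
          dsimp only
          by_cases h1 : ω ∈ B (k + 1)
          · rw [Set.indicator_of_mem h1, Set.indicator_of_mem (hsub h1),
              Set.indicator_of_notMem (fun h => h.2 h1), add_zero]
          · rw [Set.indicator_of_notMem h1, zero_add]
            by_cases h2 : ω ∈ B k
            · rw [Set.indicator_of_mem (show ω ∈ B k \ B (k + 1) from ⟨h2, h1⟩), Set.indicator_of_mem h2]
              have hA : ω ∈ A (k + 1) := by
                by_contra hA
                apply h1
                intro j hj1 hj2
                rcases Nat.lt_or_ge j (k + 1) with h | h
                · exact h2 j hj1 (by omega)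
                · have : j = k + 1 := by omega
                  rw [this]; exact hA
              obtain ⟨q1, q2, q3⟩ := hA
              simp only [Z]
              rw [Set.indicator_of_mem q3]
              apply Real.exp_le_exp.2
              have r1 := mul_le_mul_of_nonneg_left q2 ha0
              have r2 : l * t ≤ l * (M (k + 1) ω - M 0 ω) :=
                mul_le_mul_of_nonneg_left (by linarith) hl
              linarith
            · rw [Set.indicator_of_notMem h2, Set.indicator_of_notMem (fun h => h2 h.1)]
      rw [integral_add ((hZi _ hk).indicator hB2) ((integrable_const _).indicator hD),
        integral_indicator_const _ hD, smul_eq_mul] at hle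
      have := hstep k (by omega)
      rw [hcomp, add_mul]
      linarith
  have h1 := hclaim N le_rfl
  have h2 : 0 ≤ ∫ ω, (B N).indicator (Z N) ω ∂P :=
    integral_nonneg fun ω => Set.indicator_nonneg (fun ω _ => hZ0 N ω) ω
  have h3 : {ω | ∃ k, 1 ≤ k ∧ k ≤ N ∧ M k ω ≥ M 0 ω + t ∧
        (∑ i ∈ Finset.Icc 1 k, W i ω) ≤ V ∧
        (∀ i, 1 ≤ i → i ≤ k → U i ω ≤ C)} = (B N)ᶜ := by
    ext ω
    simp only [B, A, G, hS, Set.mem_ofPred_eq, Set.mem_compl_iff, not_forall, not_not, ge_iff_le,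
      exists_prop]
  rw [h3]
  linarith

/-- **Bounded variances (Freedman-type) martingale inequality** (Lemma 2.3 of Warnke):
`(M_k)_{0 ≤ k ≤ N}` is a bounded martingale for the filtration `(F_k)`,
`M_k - M_{k-1} ≤ U_k` with `U_k` being `F_{k-1}`-measurable,
`C_k = max_{i ∈ [k]} U_i` (so `C_k ≤ C` is expressed as `∀ i ∈ [k], U_i ≤ C`),
`V_k = ∑_{i ∈ [k]} Var(M_i - M_{i-1} | F_{i-1})` where
`Var(Y | F) = E((Y - E(Y|F))² | F)`, and `φ(x) = (1+x) log (1+x) - x`. -/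
theorem bounded_variances_martingale {Ω : Type*} {m0 : MeasurableSpace Ω}
    {P : Measure Ω} [IsProbabilityMeasure P]
    (N : ℕ) (ℱ : Filtration ℕ m0)
    (M : ℕ → Ω → ℝ) (hM : Martingale M ℱ P)
    (hMbdd : ∃ R : ℝ, ∀ k ω, |M k ω| ≤ R)
    (U : ℕ → Ω → ℝ)
    (hU : ∀ k, 1 ≤ k → k ≤ N → StronglyMeasurable[ℱ (k - 1)] (U k))
    (hMU : ∀ k, 1 ≤ k → k ≤ N → ∀ᵐ ω ∂P, M k ω - M (k - 1) ω ≤ U k ω)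
    (t V C : ℝ) (ht : 0 ≤ t) (hV : 0 < V) (hC : 0 < C) :
    P {ω | ∃ k, 1 ≤ k ∧ k ≤ N ∧ M k ω ≥ M 0 ω + t ∧
        (∑ i ∈ Finset.Icc 1 k,
          (P[fun ω' => (M i ω' - M (i - 1) ω' -
              (P[fun ω'' => M i ω'' - M (i - 1) ω'' | ℱ (i - 1)]) ω') ^ 2
            | ℱ (i - 1)]) ω) ≤ V ∧
        (∀ i, 1 ≤ i → i ≤ k → U i ω ≤ C)} ≤
      ENNReal.ofReal (Real.exp (-(V / C ^ 2) *
        ((1 + C * t / V) * Real.log (1 + C * t / V) - C * t / V))) ∧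
    Real.exp (-(V / C ^ 2) *
        ((1 + C * t / V) * Real.log (1 + C * t / V) - C * t / V)) ≤
      Real.exp (-t ^ 2 / (2 * V + 2 * C * t / 3)) := by
  obtain ⟨R, hR⟩ := hMbdd
  have hx : 0 ≤ C * t / V := by positivity
  constructor
  · set L := Real.log (1 + C * t / V) with hL
    have hL0 : 0 ≤ L := Real.log_nonneg (by linarith)
    have hexp : Real.exp L = 1 + C * t / V := Real.exp_log (by linarith)
    have hmain := bvm_main N ℱ M hM hR U
      (fun i => P[fun ω' => (M i ω' - M (i - 1) ω' -
              (P[fun ω'' => M i ω'' - M (i - 1) ω'' | ℱ (i - 1)]) ω') ^ 2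
            | ℱ (i - 1)])
      (fun k hk => by simpa using hU (k + 1) (by omega) (by omega))
      (fun k => stronglyMeasurable_condExp)
      (fun k => by
        simp only [Nat.add_sub_cancel]
        apply condExp_congr_ae
        have h1 := condExp_sub (hM.integrable (k + 1)) (hM.integrable k) (ℱ k)
        have h2 := hM.condExp_ae_eq (Nat.le_succ k)
        have h3 := hM.condExp_ae_eq (le_refl k)
        filter_upwards [h1, h2, h3] with ω h1 h2 h3
        have h4 : (P[fun ω => M (k + 1) ω - M k ω | ℱ k]) ω
          = (P[M (k + 1) | ℱ k]) ω - (P[M k | ℱ k]) ω := h1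
        have h5 : (P[M (k + 1) | ℱ k]) ω = M k ω := h2
        rw [h4, h3, h5]; simp)
      (fun k hk => by simpa using hMU (k + 1) (by omega) (by omega))
      t V C (L / C) _ hC (by positivity) rfl
    rw [div_mul_cancel₀ L hC.ne', hexp] at hmain
    rw [← ENNReal.ofReal_toReal (measure_ne_top P _)]
    apply ENNReal.ofReal_le_ofReal
    have he : -(V / C ^ 2) * ((1 + C * t / V) * L - C * t / V)
        = -(L / C * t - (1 + C * t / V - 1 - L) / C ^ 2 * V) := by
      field_simp
      ring
    rw [he, Real.exp_neg, ← one_div, le_div_iff₀ (Real.exp_pos _)]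
    exact hmain
  · apply Real.exp_le_exp.2
    have h := mul_le_mul_of_nonneg_left (bvm_phi hx) (show 0 ≤ V / C ^ 2 by positivity)
    have he : V / C ^ 2 * (3 * (C * t / V) ^ 2 / (6 + 2 * (C * t / V)))
        = t ^ 2 / (2 * V + 2 * C * t / 3) := by
      have h1 : 0 < 2 * V + 2 * C * t / 3 := by positivity
      have h2 : 0 < 6 + 2 * (C * t / V) := by positivity
      have h3 : 6 + 2 * (C * t / V) = 3 / V * (2 * V + 2 * C * t / 3) := by
        field_simp
        ring
      rw [h3]
      generalize 2 * V + 2 * C * t / 3 = q at h1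
      field_simp
    rw [he] at h
    rw [neg_div, neg_mul]
    linarith
end
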